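/- arXiv:2505.07143 — 2 statements merged into one kernel-verified Lean document; each statement's English description precedes it below -/
import Mathlib

section
/- Consider the parametric marginal function f(x) = max{φ₀(x, y) : y ∈ ℝᵐ, φ_j(x, y) ≤ 0 for j = 1,…,r} under assumptions (i)–(iii). Assume in addition that LICQ holds at every x (for every y ∈ Y*(x), the gradients {∇_y φ_j(x, y)}_{j∈J(x,y)} are linearly independent), so the multiplier set Λ(x) is a singleton {λ(x)}, and that ∇ₓφ_j(x, ·) is affine in y for every fixed x and each j = 0,…,r. Define Y^ε(x) = argmax{ φ₀(x, y) − (ε/2)·‖∇ₓL(x, y; λ(x))‖² : y ∈ Y(x) } and G(x, ε) = {∇ₓL(x, y; λ(x)) : y ∈ Y^ε(x)}. Then G is a descent-oriented subdifferential for f. -/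
open Filter Topology Set
open scoped RealInnerProductSpace NNReal

noncomputable section

variable {E : Type*} [NormedAddCommGroup E] [InnerProductSpace ℝ E]

/-- The Clarke generalized directional derivative of `f` at `x` in direction `d`. -/
def clarkeDeriv (f : E → ℝ) (x d : E) : ℝ :=
  Filter.limsup (fun p : E × ℝ => (f (p.1 + p.2 • d) - f p.1) / p.2)
    ((𝓝 x) ×ˢ (𝓝[>] (0 : ℝ)))

/-- The Clarke subdifferential of `f` at `x`. -/
def clarkeSubdiff (f : E → ℝ) (x : E) : Set E :=
  {v | ∀ d : E, ⟪v, d⟫ ≤ clarkeDeriv f x d}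

/-- Outer limit of `G x ε` along joint sequences `ε_k ↓ 0` and `x_k → x̄`. -/
def SeqJointLimsup (G : E → ℝ → Set E) (xbar : E) : Set E :=
  {u | ∃ (eps : ℕ → ℝ) (xs : ℕ → E) (vs : ℕ → E),
    (∀ k, 0 < eps k) ∧ Tendsto eps atTop (𝓝 0) ∧ Tendsto xs atTop (𝓝 xbar) ∧
    (∀ k, vs k ∈ G (xs k) (eps k)) ∧ Tendsto vs atTop (𝓝 u)}

/-- Outer limit `limsup_{x → xbar} S x` of a set-valued map. -/
def SetMapLimsup (S : E → Set E) (xbar : E) : Set E :=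
  {u | ∃ (xs : ℕ → E) (vs : ℕ → E),
    Tendsto xs atTop (𝓝 xbar) ∧ (∀ k, vs k ∈ S (xs k)) ∧ Tendsto vs atTop (𝓝 u)}

/-- Outer limit of a family of sets `A ε` as `ε ↓ 0`. -/
def FamilyOuterLimit (A : ℝ → Set E) : Set E :=
  {u | ∃ (eps : ℕ → ℝ) (vs : ℕ → E), (∀ k, 0 < eps k) ∧ Tendsto eps atTop (𝓝 0) ∧
    (∀ k, vs k ∈ A (eps k)) ∧ Tendsto vs atTop (𝓝 u)}

/-- Inner limit of a family of sets `A ε` as `ε ↓ 0`. -/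
def FamilyInnerLimit (A : ℝ → Set E) : Set E :=
  {u | ∀ eps : ℕ → ℝ, (∀ k, 0 < eps k) → Tendsto eps atTop (𝓝 0) →
    ∃ vs : ℕ → E, (∀ᶠ k in atTop, vs k ∈ A (eps k)) ∧ Tendsto vs atTop (𝓝 u)}

/-- Painlevé–Kuratowski convergence of the family `A ε` to the set `B` as `ε ↓ 0`. -/
def PKTendsto (A : ℝ → Set E) (B : Set E) : Prop :=
  FamilyOuterLimit A ⊆ B ∧ B ⊆ FamilyInnerLimit A

/-- `g` is the minimal-norm element of `S`. -/
def IsMinNormElt (S : Set E) (g : E) : Prop :=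
  g ∈ S ∧ ∀ v ∈ S, ‖g‖ ≤ ‖v‖

/-- A descent-oriented subdifferential for `f`:  for each fixed `ε > 0` the map
`x ↦ G x ε` is closed-valued and locally bounded, (G1) the joint outer limit as
`ε ↓ 0`, `x → x̄` is contained in the Clarke subdifferential, and (G2) the sets
`limsup_{x → x̄} G x ε` converge in the Painlevé–Kuratowski sense, as `ε ↓ 0`,
to the singleton consisting of the minimal-norm Clarke subgradient. -/
structure IsDescentOrientedSubdiff (f : E → ℝ) (G : E → ℝ → Set E) : Prop where
  closedVals : ∀ ε : ℝ, 0 < ε → ∀ x : E, IsClosed (G x ε)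
  locBounded : ∀ ε : ℝ, 0 < ε → ∀ x : E,
    ∃ δ > (0 : ℝ), ∃ M : ℝ, ∀ y : E, ‖y - x‖ < δ → ∀ v ∈ G y ε, ‖v‖ ≤ M
  outerClarke : ∀ xbar : E, SeqJointLimsup G xbar ⊆ clarkeSubdiff f xbar
  minNormLimit : ∀ xbar : E, ∃ g : E, IsMinNormElt (clarkeSubdiff f xbar) g ∧
    PKTendsto (fun ε => SetMapLimsup (fun x => G x ε) xbar) {g}

/-- Feasible set `Y(x) = {y : φ_j(x,y) ≤ 0, j = 1,…,r}`. -/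
def feasSet {n m r : ℕ}
    (φc : Fin r → EuclideanSpace ℝ (Fin n) → EuclideanSpace ℝ (Fin m) → ℝ)
    (x : EuclideanSpace ℝ (Fin n)) : Set (EuclideanSpace ℝ (Fin m)) :=
  {y | ∀ j, φc j x y ≤ 0}

/-- The marginal value `f(x) = max {φ₀(x,y) : y ∈ Y(x)}`. -/
def margVal {n m r : ℕ}
    (φ0 : EuclideanSpace ℝ (Fin n) → EuclideanSpace ℝ (Fin m) → ℝ)
    (φc : Fin r → EuclideanSpace ℝ (Fin n) → EuclideanSpace ℝ (Fin m) → ℝ)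
    (x : EuclideanSpace ℝ (Fin n)) : ℝ :=
  sSup ((φ0 x) '' feasSet φc x)

/-- The solution set `Y*(x)` of the inner maximization. -/
def solSet {n m r : ℕ}
    (φ0 : EuclideanSpace ℝ (Fin n) → EuclideanSpace ℝ (Fin m) → ℝ)
    (φc : Fin r → EuclideanSpace ℝ (Fin n) → EuclideanSpace ℝ (Fin m) → ℝ)
    (x : EuclideanSpace ℝ (Fin n)) : Set (EuclideanSpace ℝ (Fin m)) :=
  {y ∈ feasSet φc x | ∀ y' ∈ feasSet φc x, φ0 x y' ≤ φ0 x y}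

/-- The Lagrangian `L(x, y; λ) = φ₀(x,y) − Σ_j λ_j φ_j(x,y)`. -/
def lagr {n m r : ℕ}
    (φ0 : EuclideanSpace ℝ (Fin n) → EuclideanSpace ℝ (Fin m) → ℝ)
    (φc : Fin r → EuclideanSpace ℝ (Fin n) → EuclideanSpace ℝ (Fin m) → ℝ)
    (x : EuclideanSpace ℝ (Fin n)) (y : EuclideanSpace ℝ (Fin m))
    (lam : Fin r → ℝ) : ℝ :=
  φ0 x y - ∑ j, lam j * φc j x y

/-- The set `Λ(x)` of Lagrange multipliers of the inner maximization (by concavity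
it does not depend on the choice of `y ∈ Y*(x)`). -/
def multSet {n m r : ℕ}
    (φ0 : EuclideanSpace ℝ (Fin n) → EuclideanSpace ℝ (Fin m) → ℝ)
    (φc : Fin r → EuclideanSpace ℝ (Fin n) → EuclideanSpace ℝ (Fin m) → ℝ)
    (x : EuclideanSpace ℝ (Fin n)) : Set (Fin r → ℝ) :=
  {lam | (∀ j, 0 ≤ lam j) ∧ ∀ y ∈ solSet φ0 φc x,
    gradient (fun y' => lagr φ0 φc x y' lam) y = 0 ∧ ∀ j, lam j * φc j x y = 0}

/-- The regularized solution set `Y^ε(x)` of Case 1 (LICQ, unique multiplier `λ(x)`). -/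
def regSolLICQ {n m r : ℕ}
    (φ0 : EuclideanSpace ℝ (Fin n) → EuclideanSpace ℝ (Fin m) → ℝ)
    (φc : Fin r → EuclideanSpace ℝ (Fin n) → EuclideanSpace ℝ (Fin m) → ℝ)
    (lam : EuclideanSpace ℝ (Fin n) → Fin r → ℝ) (ε : ℝ)
    (x : EuclideanSpace ℝ (Fin n)) : Set (EuclideanSpace ℝ (Fin m)) :=
  {y ∈ feasSet φc x | ∀ y' ∈ feasSet φc x,
    φ0 x y' - ε / 2 * ‖gradient (fun x' => lagr φ0 φc x' y' (lam x)) x‖ ^ 2 ≤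
      φ0 x y - ε / 2 * ‖gradient (fun x' => lagr φ0 φc x' y (lam x)) x‖ ^ 2}

/-- The associated map `G(x, ε) = {∇ₓL(x, y; λ(x)) : y ∈ Y^ε(x)}`. -/
def GLICQ {n m r : ℕ}
    (φ0 : EuclideanSpace ℝ (Fin n) → EuclideanSpace ℝ (Fin m) → ℝ)
    (φc : Fin r → EuclideanSpace ℝ (Fin n) → EuclideanSpace ℝ (Fin m) → ℝ)
    (lam : EuclideanSpace ℝ (Fin n) → Fin r → ℝ)
    (x : EuclideanSpace ℝ (Fin n)) (ε : ℝ) : Set (EuclideanSpace ℝ (Fin n)) :=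
  (fun y => gradient (fun x' => lagr φ0 φc x' y (lam x)) x) '' regSolLICQ φ0 φc lam ε x


/-- Standing hypotheses used in the proof. -/
structure PMHyp {n m r : ℕ}
    (φ0 : EuclideanSpace ℝ (Fin n) → EuclideanSpace ℝ (Fin m) → ℝ)
    (φc : Fin r → EuclideanSpace ℝ (Fin n) → EuclideanSpace ℝ (Fin m) → ℝ)
    (lam : EuclideanSpace ℝ (Fin n) → Fin r → ℝ) : Prop where
  hs0 : ContDiff ℝ 1 fun p : EuclideanSpace ℝ (Fin n) × EuclideanSpace ℝ (Fin m) => φ0 p.1 p.2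
  hsc : ∀ j, ContDiff ℝ 1
    fun p : EuclideanSpace ℝ (Fin n) × EuclideanSpace ℝ (Fin m) => φc j p.1 p.2
  hconc : ∀ x, ConcaveOn ℝ Set.univ (φ0 x)
  hconv : ∀ j x, ConvexOn ℝ Set.univ (φc j x)
  hne : ∀ x, (feasSet φc x).Nonempty
  hlocbdd : ∀ x : EuclideanSpace ℝ (Fin n), ∃ δ > (0 : ℝ), ∃ M : ℝ,
      ∀ x' : EuclideanSpace ℝ (Fin n), ‖x' - x‖ < δ → ∀ y ∈ feasSet φc x', ‖y‖ ≤ M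
  hMFCQ : ∀ x, ∀ y ∈ solSet φ0 φc x, ∃ w : EuclideanSpace ℝ (Fin m),
      ∀ j, φc j x y = 0 → ⟪gradient (fun y' => φc j x y') y, w⟫ < 0
  hlam : ∀ x, multSet φ0 φc x = {lam x}
  haff0 : ∀ x : EuclideanSpace ℝ (Fin n),
      ∃ (T : EuclideanSpace ℝ (Fin m) →L[ℝ] EuclideanSpace ℝ (Fin n))
        (b : EuclideanSpace ℝ (Fin n)),
        ∀ y, gradient (fun x' => φ0 x' y) x = T y + b
  haffc : ∀ (j : Fin r) (x : EuclideanSpace ℝ (Fin n)),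
      ∃ (T : EuclideanSpace ℝ (Fin m) →L[ℝ] EuclideanSpace ℝ (Fin n))
        (b : EuclideanSpace ℝ (Fin n)),
        ∀ y, gradient (fun x' => φc j x' y) x = T y + b

/-- The partial gradient of the Lagrangian in `x`. -/
def pmV {n m r : ℕ}
    (φ0 : EuclideanSpace ℝ (Fin n) → EuclideanSpace ℝ (Fin m) → ℝ)
    (φc : Fin r → EuclideanSpace ℝ (Fin n) → EuclideanSpace ℝ (Fin m) → ℝ)
    (x : EuclideanSpace ℝ (Fin n)) (y : EuclideanSpace ℝ (Fin m))
    (l : Fin r → ℝ) : EuclideanSpace ℝ (Fin n) :=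
  gradient (fun x' => lagr φ0 φc x' y l) x

/-- The partial gradient of the Lagrangian in `y`. -/
def pmW {n m r : ℕ}
    (φ0 : EuclideanSpace ℝ (Fin n) → EuclideanSpace ℝ (Fin m) → ℝ)
    (φc : Fin r → EuclideanSpace ℝ (Fin n) → EuclideanSpace ℝ (Fin m) → ℝ)
    (x : EuclideanSpace ℝ (Fin n)) (y : EuclideanSpace ℝ (Fin m))
    (l : Fin r → ℝ) : EuclideanSpace ℝ (Fin m) :=
  gradient (fun y' => lagr φ0 φc x y' l) y

/-- A concave function with vanishing gradient at `a` is maximal at `a`. -/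
theorem pm_concave_crit {F : Type*} [NormedAddCommGroup F] [InnerProductSpace ℝ F]
    [CompleteSpace F] {g : F → ℝ} (hg : ConcaveOn ℝ Set.univ g) {a : F}
    (hd : DifferentiableAt ℝ g a) (h0 : gradient g a = 0) (b : F) : g b ≤ g a := by
  have h1 : HasFDerivAt g (0 : F →L[ℝ] ℝ) a := by
    have := hd.hasGradientAt
    rw [h0, hasGradientAt_iff_hasFDerivAt] at this
    simpa using this
  have hc : ConcaveOn ℝ Set.univ (g ∘ AffineMap.lineMap (k := ℝ) a b) := by
    simpa using hg.comp_affineMap (AffineMap.lineMap (k := ℝ) a b)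
  have h2 : HasDerivAt (g ∘ AffineMap.lineMap (k := ℝ) a b) 0 0 := by
    have hl : HasDerivAt (AffineMap.lineMap (k := ℝ) a b) (b - a) (0 : ℝ) :=
      AffineMap.hasDerivAt_lineMap
    have h1' : HasFDerivAt g (0 : F →L[ℝ] ℝ) (AffineMap.lineMap (k := ℝ) a b (0 : ℝ)) := by
      simpa using h1
    simpa using h1'.comp_hasDerivAt (0 : ℝ) hl
  have := hc.slope_le_of_hasDerivAt (mem_univ 0) (mem_univ 1) one_pos h2
  simp [slope] at this
  linarith

/-- If `g 0 = 0` and `g' 0 < 0` then `g` is negative just to the right of `0`. -/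
theorem pm_neg_right {g : ℝ → ℝ} {g' : ℝ} (h : HasDerivAt g g' 0) (hg : g 0 = 0) (hneg : g' < 0) :
    ∀ᶠ t in 𝓝[>] (0 : ℝ), g t < 0 := by
  have h1 := (hasDerivAt_iff_tendsto_slope.1 h).eventually (gt_mem_nhds hneg)
  have h2 : 𝓝[>] (0 : ℝ) ≤ 𝓝[≠] 0 := nhdsWithin_mono _ (fun t ht => ne_of_gt ht)
  filter_upwards [h2 h1, self_mem_nhdsWithin] with t ht ht0
  simp only [slope, hg, vsub_eq_sub, sub_zero, smul_eq_mul] at ht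
  have ht0 : 0 < t := ht0
  by_contra hc
  have : 0 ≤ t⁻¹ * g t := mul_nonneg (inv_nonneg.2 ht0.le) (not_lt.1 hc)
  linarith

namespace PMHyp

variable {n m r : ℕ} {φ0 : EuclideanSpace ℝ (Fin n) → EuclideanSpace ℝ (Fin m) → ℝ}
  {φc : Fin r → EuclideanSpace ℝ (Fin n) → EuclideanSpace ℝ (Fin m) → ℝ}
  {lam : EuclideanSpace ℝ (Fin n) → Fin r → ℝ}

theorem contL (h : PMHyp φ0 φc lam) :
    ContDiff ℝ 1 (fun p : EuclideanSpace ℝ (Fin n) × EuclideanSpace ℝ (Fin m) × (Fin r → ℝ) =>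
      lagr φ0 φc p.1 p.2.1 p.2.2) := by
  unfold lagr
  have h0 := h.hs0
  have hc := h.hsc
  refine ContDiff.sub ?_ (ContDiff.sum fun j _ => ContDiff.mul ?_ ?_)
  · exact h0.comp (contDiff_fst.prodMk (contDiff_fst.comp contDiff_snd))
  · exact (contDiff_apply ℝ ℝ j).comp (contDiff_snd.comp contDiff_snd)
  · exact (hc j).comp (contDiff_fst.prodMk (contDiff_fst.comp contDiff_snd))

theorem cont0 (h : PMHyp φ0 φc lam) : Continuous
    (fun p : EuclideanSpace ℝ (Fin n) × EuclideanSpace ℝ (Fin m) => φ0 p.1 p.2) :=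
  h.hs0.continuous

theorem contc (h : PMHyp φ0 φc lam) (j : Fin r) : Continuous
    (fun p : EuclideanSpace ℝ (Fin n) × EuclideanSpace ℝ (Fin m) => φc j p.1 p.2) :=
  (h.hsc j).continuous

theorem contV (h : PMHyp φ0 φc lam) :
    Continuous (fun p : EuclideanSpace ℝ (Fin n) × EuclideanSpace ℝ (Fin m) × (Fin r → ℝ) =>
      pmV φ0 φc p.1 p.2.1 p.2.2) := by
  have hL := h.contL
  have : ContDiff ℝ 0
      (fun p : EuclideanSpace ℝ (Fin n) × EuclideanSpace ℝ (Fin m) × (Fin r → ℝ) =>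
      fderiv ℝ (fun x' => lagr φ0 φc x' p.2.1 p.2.2) p.1) := by
    refine ContDiff.fderiv (m := 1)
      (f := fun (p : EuclideanSpace ℝ (Fin n) × EuclideanSpace ℝ (Fin m) × (Fin r → ℝ)) x' =>
        lagr φ0 φc x' p.2.1 p.2.2) (g := fun p => p.1) ?_ contDiff_fst (by simp)
    exact hL.comp (contDiff_snd.prodMk (contDiff_snd.comp contDiff_fst))
  exact (LinearIsometryEquiv.continuous _).comp this.continuous

theorem contW (h : PMHyp φ0 φc lam) :
    Continuous (fun p : EuclideanSpace ℝ (Fin n) × EuclideanSpace ℝ (Fin m) × (Fin r → ℝ) =>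
      pmW φ0 φc p.1 p.2.1 p.2.2) := by
  have hL := h.contL
  have : ContDiff ℝ 0
      (fun p : EuclideanSpace ℝ (Fin n) × EuclideanSpace ℝ (Fin m) × (Fin r → ℝ) =>
      fderiv ℝ (fun y' => lagr φ0 φc p.1 y' p.2.2) p.2.1) := by
    refine ContDiff.fderiv (m := 1)
      (f := fun (p : EuclideanSpace ℝ (Fin n) × EuclideanSpace ℝ (Fin m) × (Fin r → ℝ)) y' =>
        lagr φ0 φc p.1 y' p.2.2) (g := fun p => p.2.1) ?_ (contDiff_fst.comp contDiff_snd)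
        (by simp)
    exact hL.comp ((contDiff_fst.comp contDiff_fst).prodMk
      (contDiff_snd.prodMk ((contDiff_snd.comp contDiff_snd).comp contDiff_fst)))
  exact (LinearIsometryEquiv.continuous _).comp this.continuous

theorem diffx (h : PMHyp φ0 φc lam) (y : EuclideanSpace ℝ (Fin m)) (l : Fin r → ℝ) :
    Differentiable ℝ (fun x' => lagr φ0 φc x' y l) :=
  (h.contL.comp (contDiff_id.prodMk contDiff_const : ContDiff ℝ 1
    fun x' : EuclideanSpace ℝ (Fin n) => (x', (y, l)))).differentiable (by simp)

theorem diffy (h : PMHyp φ0 φc lam) (x : EuclideanSpace ℝ (Fin n)) (l : Fin r → ℝ) :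
    Differentiable ℝ (fun y' => lagr φ0 φc x y' l) :=
  (h.contL.comp (contDiff_const.prodMk (contDiff_id.prodMk contDiff_const) : ContDiff ℝ 1
    fun y' : EuclideanSpace ℝ (Fin m) => (x, (y', l)))).differentiable (by simp)

/-- limits of continuous data -/
theorem tends0 (h : PMHyp φ0 φc lam) {ι : Type*} {F : Filter ι}
    {xs : ι → EuclideanSpace ℝ (Fin n)} {ys : ι → EuclideanSpace ℝ (Fin m)} {x y}
    (hx : Tendsto xs F (𝓝 x)) (hy : Tendsto ys F (𝓝 y)) :
    Tendsto (fun k => φ0 (xs k) (ys k)) F (𝓝 (φ0 x y)) :=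
  (h.cont0.tendsto (x, y)).comp (hx.prodMk_nhds hy)

theorem tendsc (h : PMHyp φ0 φc lam) (j : Fin r) {ι : Type*} {F : Filter ι}
    {xs : ι → EuclideanSpace ℝ (Fin n)} {ys : ι → EuclideanSpace ℝ (Fin m)} {x y}
    (hx : Tendsto xs F (𝓝 x)) (hy : Tendsto ys F (𝓝 y)) :
    Tendsto (fun k => φc j (xs k) (ys k)) F (𝓝 (φc j x y)) :=
  ((h.contc j).tendsto (x, y)).comp (hx.prodMk_nhds hy)

theorem tendsV (h : PMHyp φ0 φc lam) {ι : Type*} {F : Filter ι}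
    {xs : ι → EuclideanSpace ℝ (Fin n)} {ys : ι → EuclideanSpace ℝ (Fin m)}
    {ls : ι → Fin r → ℝ} {x : EuclideanSpace ℝ (Fin n)} {y : EuclideanSpace ℝ (Fin m)}
    {l : Fin r → ℝ}
    (hx : Tendsto xs F (𝓝 x)) (hy : Tendsto ys F (𝓝 y)) (hl : Tendsto ls F (𝓝 l)) :
    Tendsto (fun k => pmV φ0 φc (xs k) (ys k) (ls k)) F (𝓝 (pmV φ0 φc x y l)) := by
  have h1 : Tendsto (fun k => (xs k, (ys k, ls k))) F (𝓝 (x, (y, l))) :=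
    hx.prodMk_nhds (hy.prodMk_nhds hl)
  have h2 := h.contV.tendsto (x, (y, l))
  have h3 := Tendsto.comp h2 h1
  simpa only [Function.comp_def] using h3

theorem tendsW (h : PMHyp φ0 φc lam) {ι : Type*} {F : Filter ι}
    {xs : ι → EuclideanSpace ℝ (Fin n)} {ys : ι → EuclideanSpace ℝ (Fin m)}
    {ls : ι → Fin r → ℝ} {x : EuclideanSpace ℝ (Fin n)} {y : EuclideanSpace ℝ (Fin m)}
    {l : Fin r → ℝ}
    (hx : Tendsto xs F (𝓝 x)) (hy : Tendsto ys F (𝓝 y)) (hl : Tendsto ls F (𝓝 l)) :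
    Tendsto (fun k => pmW φ0 φc (xs k) (ys k) (ls k)) F (𝓝 (pmW φ0 φc x y l)) := by
  have h1 : Tendsto (fun k => (xs k, (ys k, ls k))) F (𝓝 (x, (y, l))) :=
    hx.prodMk_nhds (hy.prodMk_nhds hl)
  have h2 := h.contW.tendsto (x, (y, l))
  have h3 := Tendsto.comp h2 h1
  simpa only [Function.comp_def] using h3

theorem feas_limit (h : PMHyp φ0 φc lam)
    {xs : ℕ → EuclideanSpace ℝ (Fin n)} {ys : ℕ → EuclideanSpace ℝ (Fin m)} {x y}
    (hx : Tendsto xs atTop (𝓝 x)) (hy : Tendsto ys atTop (𝓝 y))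
    (hf : ∀ k, ys k ∈ feasSet φc (xs k)) : y ∈ feasSet φc x := fun j =>
  le_of_tendsto' (h.tendsc j hx hy) fun k => hf k j

theorem feas_subseq (h : PMHyp φ0 φc lam)
    {xs : ℕ → EuclideanSpace ℝ (Fin n)} {ys : ℕ → EuclideanSpace ℝ (Fin m)} {x}
    (hx : Tendsto xs atTop (𝓝 x)) (hf : ∀ k, ys k ∈ feasSet φc (xs k)) :
    ∃ y ∈ feasSet φc x, ∃ θ : ℕ → ℕ, StrictMono θ ∧ Tendsto (ys ∘ θ) atTop (𝓝 y) := by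
  obtain ⟨δ, hδ, M, hM⟩ := h.hlocbdd x
  have hev : ∀ᶠ k in atTop, ys k ∈ Metric.closedBall (0 : EuclideanSpace ℝ (Fin m)) M := by
    filter_upwards [hx (Metric.ball_mem_nhds x hδ)] with k hk
    have hk : xs k ∈ Metric.ball x δ := hk
    rw [mem_ball_iff_norm] at hk
    simpa using hM _ hk _ (hf k)
  obtain ⟨y, -, θ, hθ, hy⟩ := tendsto_subseq_of_frequently_bounded
    Metric.isBounded_closedBall hev.frequently
  exact ⟨y, h.feas_limit (hx.comp hθ.tendsto_atTop) hy (fun k => hf (θ k)), θ, hθ, hy⟩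

theorem feas_compact (h : PMHyp φ0 φc lam) (x) : IsCompact (feasSet φc x) := by
  obtain ⟨δ, hδ, M, hM⟩ := h.hlocbdd x
  refine (isCompact_closedBall (0 : EuclideanSpace ℝ (Fin m)) M).of_isClosed_subset ?_ ?_
  · have : feasSet φc x = ⋂ j, {y | φc j x y ≤ 0} := by ext; simp [feasSet]
    rw [this]
    exact isClosed_iInter fun j =>
      isClosed_le ((h.contc j).comp (Continuous.prodMk_right x)) continuous_const
  · intro y hy
    simpa using hM x (by simpa using hδ) y hy

theorem sol_nonempty (h : PMHyp φ0 φc lam) (x) : (solSet φ0 φc x).Nonempty := by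
  obtain ⟨y, hy, hm⟩ := (h.feas_compact x).exists_isMaxOn (h.hne x)
    (f := φ0 x) (h.cont0.comp (Continuous.prodMk_right x)).continuousOn
  exact ⟨y, hy, fun y' hy' => hm hy'⟩

theorem marg_eq {x y} (hy : y ∈ solSet φ0 φc x) : margVal φ0 φc x = φ0 x y := by
  refine IsGreatest.csSup_eq ⟨⟨y, hy.1, rfl⟩, ?_⟩
  rintro _ ⟨y', hy', rfl⟩
  exact hy.2 y' hy'

theorem slater (h : PMHyp φ0 φc lam) (x) : ∃ y, ∀ j, φc j x y < 0 := by
  obtain ⟨y, hy⟩ := h.sol_nonempty x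
  obtain ⟨w, hw⟩ := h.hMFCQ x y hy
  have hl : HasDerivAt (fun t : ℝ => y + t • w) w 0 := by
    simpa using ((hasDerivAt_id (0 : ℝ)).smul_const w).const_add y
  have key : ∀ᶠ t in 𝓝[>] (0 : ℝ), ∀ j, φc j x (y + t • w) < 0 := by
    rw [eventually_all]
    intro j
    rcases (hy.1 j).lt_or_eq with hlt | heq
    · have hc : Continuous (fun t : ℝ => φc j x (y + t • w)) :=
        (h.contc j).comp (by fun_prop : Continuous fun t : ℝ => (x, y + t • w))
      have := (hc.tendsto 0).eventually_lt_const (u := 0) (by simpa using hlt)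
      exact nhdsWithin_le_nhds this
    · have hd : DifferentiableAt ℝ (fun y' => φc j x y') y :=
        (((h.hsc j).comp (contDiff_const.prodMk contDiff_id :
          ContDiff ℝ 1 fun y' => (x, y'))).differentiable (by simp)) y
      have h1 := hd.hasGradientAt.hasFDerivAt
      have h1' : HasFDerivAt (fun y' => φc j x y')
        ((InnerProductSpace.toDual ℝ _) (gradient (fun y' => φc j x y') y))
          (y + (0 : ℝ) • w) := by simpa using h1
      have h2 := h1'.comp_hasDerivAt (0 : ℝ) hl
      refine pm_neg_right h2 (by simpa using heq) ?_
      simpa using hw j heq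
  obtain ⟨t, ht⟩ := key.exists
  exact ⟨_, ht⟩

theorem feas_strict_closure (h : PMHyp φ0 φc lam) (x) :
    feasSet φc x ⊆ closure {y | ∀ j, φc j x y < 0} := by
  intro y hy
  obtain ⟨z, hz⟩ := h.slater x
  have hc : Tendsto (fun t : ℝ => (1 - t) • y + t • z) (𝓝[>] 0) (𝓝 y) := by
    have : Continuous (fun t : ℝ => (1 - t) • y + t • z) := by fun_prop
    simpa using (this.tendsto 0).mono_left nhdsWithin_le_nhds
  refine mem_closure_of_tendsto hc ?_
  have : Set.Ioo (0 : ℝ) 1 ∈ 𝓝[>] (0 : ℝ) := Ioo_mem_nhdsGT one_pos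
  filter_upwards [this] with t ht j
  have h1 := (h.hconv j x).2 (mem_univ y) (mem_univ z) (by linarith [ht.2] : 0 ≤ 1 - t)
    ht.1.le (by ring)
  simp only [smul_eq_mul] at h1
  have h2 := mul_nonpos_of_nonneg_of_nonpos (by linarith [ht.2] : 0 ≤ 1 - t) (hy j)
  have h3 := mul_neg_of_pos_of_neg ht.1 (hz j)
  linarith

theorem argmax_limit (h : PMHyp φ0 φc lam)
    {xs : ℕ → EuclideanSpace ℝ (Fin n)} {ys : ℕ → EuclideanSpace ℝ (Fin m)} {x y}
    {Ψ : ℕ → EuclideanSpace ℝ (Fin m) → ℝ} {Ψ' : EuclideanSpace ℝ (Fin m) → ℝ}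
    (hx : Tendsto xs atTop (𝓝 x)) (hc : Continuous Ψ')
    (hp : ∀ z, Tendsto (fun k => Ψ k z) atTop (𝓝 (Ψ' z)))
    (hy : Tendsto (fun k => Ψ k (ys k)) atTop (𝓝 (Ψ' y)))
    (hm : ∀ k, ∀ z ∈ feasSet φc (xs k), Ψ k z ≤ Ψ k (ys k)) :
    ∀ z ∈ feasSet φc x, Ψ' z ≤ Ψ' y := by
  have : closure {y | ∀ j, φc j x y < 0} ⊆ {z | Ψ' z ≤ Ψ' y} := by
    refine closure_minimal ?_ (isClosed_le hc continuous_const)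
    intro z hz
    refine le_of_tendsto_of_tendsto (hp z) hy ?_
    have : ∀ᶠ k in atTop, ∀ j, φc j (xs k) z < 0 := by
      rw [eventually_all]
      exact fun j => (h.tendsc j hx tendsto_const_nhds).eventually (gt_mem_nhds (hz j))
    filter_upwards [this] with k hk
    exact hm k z (fun j => (hk j).le)
  exact fun z hz => this (h.feas_strict_closure x hz)

theorem sol_limit (h : PMHyp φ0 φc lam)
    {xs : ℕ → EuclideanSpace ℝ (Fin n)} {ys : ℕ → EuclideanSpace ℝ (Fin m)} {x y}
    (hx : Tendsto xs atTop (𝓝 x)) (hy : Tendsto ys atTop (𝓝 y))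
    (hf : ∀ k, ys k ∈ solSet φ0 φc (xs k)) : y ∈ solSet φ0 φc x :=
  ⟨h.feas_limit hx hy (fun k => (hf k).1),
    h.argmax_limit (Ψ := fun k => φ0 (xs k)) hx (h.cont0.comp (Continuous.prodMk_right x))
      (fun z => h.tends0 hx tendsto_const_nhds) (h.tends0 hx hy) (fun k => (hf k).2)⟩

theorem lagr_concave (h : PMHyp φ0 φc lam) (x) {l : Fin r → ℝ} (hl : ∀ j, 0 ≤ l j) :
    ConcaveOn ℝ Set.univ (fun y => lagr φ0 φc x y l) := by
  refine ⟨convex_univ, fun y _ z _ a b ha hb hab => ?_⟩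
  have h0 := (h.hconc x).2 (mem_univ y) (mem_univ z) ha hb hab
  simp only [smul_eq_mul, lagr] at *
  have h1 : ∑ j, l j * φc j x (a • y + b • z) ≤
      ∑ j, (a * (l j * φc j x y) + b * (l j * φc j x z)) := by
    refine Finset.sum_le_sum fun j _ => ?_
    have := mul_le_mul_of_nonneg_left
      ((h.hconv j x).2 (mem_univ y) (mem_univ z) ha hb hab) (hl j)
    simp only [smul_eq_mul] at this
    linarith
  rw [Finset.sum_add_distrib, ← Finset.mul_sum, ← Finset.mul_sum] at h1
  linarith

/-- A KKT pair gives a global bound on the Lagrangian. -/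
theorem lagr_le (h : PMHyp φ0 φc lam) {x y} {l : Fin r → ℝ} (hl : ∀ j, 0 ≤ l j)
    (hy : y ∈ solSet φ0 φc x) (hW : pmW φ0 φc x y l = 0) (hcs : ∀ j, l j * φc j x y = 0) (z) :
    lagr φ0 φc x z l ≤ margVal φ0 φc x := by
  have := pm_concave_crit (h.lagr_concave x hl) (h.diffy x l y) hW z
  rw [marg_eq hy]
  simpa [lagr, hcs] using this

theorem lam_mem (h : PMHyp φ0 φc lam) (x) : lam x ∈ multSet φ0 φc x := by simp [h.hlam x]

theorem lam_le (h : PMHyp φ0 φc lam) (x z) : lagr φ0 φc x z (lam x) ≤ margVal φ0 φc x := by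
  obtain ⟨y, hy⟩ := h.sol_nonempty x
  have hm := h.lam_mem x
  exact h.lagr_le hm.1 hy (hm.2 y hy).1 (hm.2 y hy).2 z

theorem feas_le_lagr {x y} (hy : y ∈ feasSet φc x) {l : Fin r → ℝ} (hl : ∀ j, 0 ≤ l j) :
    φ0 x y ≤ lagr φ0 φc x y l := by
  have : ∑ j, l j * φc j x y ≤ 0 :=
    Finset.sum_nonpos fun j _ => mul_nonpos_of_nonneg_of_nonpos (hl j) (hy j)
  unfold lagr
  linarith

theorem lam_unique (h : PMHyp φ0 φc lam) {x y} {l : Fin r → ℝ} (hl : ∀ j, 0 ≤ l j)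
    (hy : y ∈ solSet φ0 φc x) (hW : pmW φ0 φc x y l = 0) (hcs : ∀ j, l j * φc j x y = 0) :
    l = lam x := by
  have : l ∈ multSet φ0 φc x := by
    refine ⟨hl, fun z hz => ?_⟩
    have hle := h.lagr_le hl hy hW hcs
    have hge := feas_le_lagr (φ0 := φ0) hz.1 hl
    rw [← marg_eq hz] at hge
    have heq := le_antisymm (hle z) hge
    constructor
    · have hmax : IsLocalMax (fun y' => lagr φ0 φc x y' l) z :=
        Filter.Eventually.of_forall fun y' => by
          have := hle y'
          simp only
          linarith
      have := hmax.fderiv_eq_zero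
      simp [gradient, this]
    · have hs : ∑ j, l j * φc j x z = 0 := by
        rw [marg_eq hz] at heq
        unfold lagr at heq
        linarith
      have := (Finset.sum_eq_zero_iff_of_nonpos
        (fun j _ => mul_nonpos_of_nonneg_of_nonpos (hl j) (hz.1 j))).1 hs
      exact fun j => this j (Finset.mem_univ j)
  simpa [h.hlam x] using this

theorem marg_bdd (h : PMHyp φ0 φc lam) (x) : ∃ K, ∀ᶠ x' in 𝓝 x, margVal φ0 φc x' ≤ K := by
  obtain ⟨δ, hδ, M, hM⟩ := h.hlocbdd x
  obtain ⟨K, hK⟩ := ((isCompact_closedBall x δ).prod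
    (isCompact_closedBall (0 : EuclideanSpace ℝ (Fin m)) M)).exists_bound_of_continuousOn
      h.cont0.continuousOn
  refine ⟨K, ?_⟩
  filter_upwards [Metric.ball_mem_nhds x hδ] with x' hx'
  obtain ⟨y, hy⟩ := h.sol_nonempty x'
  rw [marg_eq hy]
  have h1 := hM x' (mem_ball_iff_norm.1 hx') y hy.1
  exact (le_abs_self _).trans (hK (x', y) ⟨Metric.ball_subset_closedBall hx', by simpa using h1⟩)

theorem lam_bdd (h : PMHyp φ0 φc lam) (x) :
    ∃ b : Fin r → ℝ, ∀ᶠ x' in 𝓝 x, lam x' ∈ Set.Icc 0 b := by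
  obtain ⟨K, hK⟩ := h.marg_bdd x
  obtain ⟨z, hz⟩ := h.slater x
  have h0 : ∀ᶠ x' in 𝓝 x, φ0 x z - 1 < φ0 x' z :=
    (h.tends0 tendsto_id tendsto_const_nhds).eventually_const_lt (by linarith)
  have h1 : ∀ᶠ x' in 𝓝 x, ∀ j, φc j x' z < φc j x z / 2 := by
    rw [eventually_all]
    exact fun j => (h.tendsc j tendsto_id tendsto_const_nhds).eventually_lt_const
      (by linarith [hz j])
  refine ⟨fun j => (K - (φ0 x z - 1)) / (-(φc j x z / 2)), ?_⟩
  filter_upwards [hK, h0, h1] with x' a0 a1 a2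
  have hpos := (h.lam_mem x').1
  refine ⟨hpos, fun j => ?_⟩
  have hle := h.lam_le x' z
  have hzj := hz j
  rw [le_div_iff₀ (by linarith)]
  have hs : ∑ i, lam x' i * φc i x' z ≤ lam x' j * φc j x' z := by
    have := Finset.single_le_sum (f := fun i => -(lam x' i * φc i x' z)) (s := Finset.univ)
      (fun i _ => by
        have : lam x' i * φc i x' z ≤ 0 :=
          mul_nonpos_of_nonneg_of_nonpos (hpos i) (by linarith [a2 i, hz i])
        linarith) (Finset.mem_univ j)
    simp only [Finset.sum_neg_distrib] at this
    linarith
  have h3 := mul_le_mul_of_nonneg_left (a2 j).le (hpos j)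
  unfold lagr at hle
  linarith

theorem lam_tendsto (h : PMHyp φ0 φc lam) (x) : Tendsto lam (𝓝 x) (𝓝 (lam x)) := by
  obtain ⟨b, hb⟩ := h.lam_bdd x
  refine tendsto_of_seq_tendsto fun xs hxs => ?_
  refine tendsto_of_subseq_tendsto fun ns hns => ?_
  have hz : Tendsto (xs ∘ ns) atTop (𝓝 x) := hxs.comp hns
  choose Y hY using h.sol_nonempty
  obtain ⟨y, -, θ, hθ, hy⟩ := h.feas_subseq (ys := fun k => Y (xs (ns k))) hz
    (fun k => (hY _).1)
  have hz' : Tendsto (fun k => xs (ns (θ k))) atTop (𝓝 x) := hz.comp hθ.tendsto_atTop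
  obtain ⟨l, hl, η, hη, hl'⟩ := (isCompact_Icc (a := (0 : Fin r → ℝ)) (b := b)).tendsto_subseq'
    (x := fun k => lam (xs (ns (θ k)))) (hz'.eventually hb).frequently
  have hz2 : Tendsto (fun k => xs (ns (θ (η k)))) atTop (𝓝 x) := hz'.comp hη.tendsto_atTop
  have hy2 : Tendsto (fun k => Y (xs (ns (θ (η k))))) atTop (𝓝 y) := hy.comp hη.tendsto_atTop
  have hl2 : Tendsto (fun k => lam (xs (ns (θ (η k))))) atTop (𝓝 l) := hl'
  have hsol := h.sol_limit hz2 hy2 (fun k => hY _)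
  have hW : pmW φ0 φc x y l = 0 := by
    refine tendsto_nhds_unique (h.tendsW hz2 hy2 hl2) ?_
    refine tendsto_const_nhds.congr fun k => ?_
    exact (((h.lam_mem _).2 _ (hY _)).1).symm
  have hcs : ∀ j, l j * φc j x y = 0 := by
    intro j
    have hlj : Tendsto (fun k => lam (xs (ns (θ (η k)))) j) atTop (𝓝 (l j)) :=
      (tendsto_pi_nhds.1 hl2) j
    refine tendsto_nhds_unique (hlj.mul (h.tendsc j hz2 hy2)) ?_
    refine tendsto_const_nhds.congr fun k => ?_
    exact (((h.lam_mem _).2 _ (hY _)).2 j).symm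
  have hlx := h.lam_unique hl.1 hsol hW hcs
  exact ⟨θ ∘ η, by rw [← hlx]; exact hl2⟩

theorem mvt (h : PMHyp φ0 φc lam) (x d : EuclideanSpace ℝ (Fin n)) (y l) {t : ℝ} (ht : 0 < t) :
    ∃ s ∈ Set.Ioo 0 t, ⟪pmV φ0 φc (x + s • d) y l, d⟫ =
      (lagr φ0 φc (x + t • d) y l - lagr φ0 φc x y l) / t := by
  have hd : ∀ s : ℝ, HasDerivAt (fun s : ℝ => lagr φ0 φc (x + s • d) y l)
      ⟪pmV φ0 φc (x + s • d) y l, d⟫ s := by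
    intro s
    have hl : HasDerivAt (fun s : ℝ => x + s • d) d s := by
      simpa using ((hasDerivAt_id s).smul_const d).const_add x
    have h1 := (h.diffx y l (x + s • d)).hasFDerivAt
    have h2 := h1.comp_hasDerivAt s hl
    rw [← inner_gradient_left] at h2
    exact h2
  obtain ⟨s, hs, he⟩ := exists_hasDerivAt_eq_slope _ _ ht
    (fun s _ => (hd s).continuousAt.continuousWithinAt) (fun s _ => hd s)
  exact ⟨s, hs, by simpa using he⟩

theorem clarke_upper (h : PMHyp φ0 φc lam) {x d : EuclideanSpace ℝ (Fin n)} {c : ℝ}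
    (hc : ∀ y ∈ solSet φ0 φc x, ⟪pmV φ0 φc x y (lam x), d⟫ < c) :
    ∀ᶠ p : EuclideanSpace ℝ (Fin n) × ℝ in (𝓝 x) ×ˢ (𝓝[>] (0 : ℝ)),
      (margVal φ0 φc (p.1 + p.2 • d) - margVal φ0 φc p.1) / p.2 ≤ c := by
  by_contra hcon
  have hpos : ∀ᶠ p : EuclideanSpace ℝ (Fin n) × ℝ in (𝓝 x) ×ˢ (𝓝[>] (0 : ℝ)), 0 < p.2 :=
    tendsto_snd.eventually self_mem_nhdsWithin
  obtain ⟨ps, hps, hp⟩ := exists_seq_forall_of_frequently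
    ((not_eventually.1 hcon).and_eventually hpos)
  have hx : Tendsto (fun k => (ps k).1) atTop (𝓝 x) := tendsto_fst.comp hps
  have ht : Tendsto (fun k => (ps k).2) atTop (𝓝 0) :=
    (tendsto_snd.comp hps).mono_right nhdsWithin_le_nhds
  choose Y hY using h.sol_nonempty
  have key : ∀ k, ∃ s ∈ Set.Ioo 0 (ps k).2, c ≤ ⟪pmV φ0 φc ((ps k).1 + s • d)
      (Y ((ps k).1 + (ps k).2 • d)) (lam (ps k).1), d⟫ := by
    intro k
    obtain ⟨s, hs, he⟩ := h.mvt (ps k).1 d (Y ((ps k).1 + (ps k).2 • d)) (lam (ps k).1) (hp k).2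
    refine ⟨s, hs, ?_⟩
    rw [he]
    refine (not_le.1 (hp k).1).le.trans ?_
    have h1 := h.lam_le (ps k).1 (Y ((ps k).1 + (ps k).2 • d))
    have h2 := feas_le_lagr (φ0 := φ0) (hY ((ps k).1 + (ps k).2 • d)).1 (h.lam_mem (ps k).1).1
    rw [← marg_eq (hY _)] at h2
    exact div_le_div_of_nonneg_right (by linarith) (hp k).2.le
  choose s hs hcs using key
  have hst : Tendsto s atTop (𝓝 0) :=
    tendsto_of_tendsto_of_tendsto_of_le_of_le tendsto_const_nhds ht
      (fun k => (hs k).1.le) (fun k => (hs k).2.le)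
  have hadd : ∀ {u : ℕ → ℝ}, Tendsto u atTop (𝓝 0) →
      Tendsto (fun k => (ps k).1 + u k • d) atTop (𝓝 x) := by
    intro u hu
    simpa using hx.add (hu.smul_const d)
  obtain ⟨y, -, θ, hθ, hy⟩ := h.feas_subseq (ys := fun k => Y ((ps k).1 + (ps k).2 • d))
    (hadd ht) (fun k => (hY _).1)
  have hsol := h.sol_limit ((hadd ht).comp hθ.tendsto_atTop) hy (fun k => hY _)
  have hV := h.tendsV ((hadd hst).comp hθ.tendsto_atTop) hy
    (((h.lam_tendsto x).comp hx).comp hθ.tendsto_atTop)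
  have := ge_of_tendsto' (hV.inner (tendsto_const_nhds (x := d))) (fun k => hcs (θ k))
  exact absurd (hc y hsol) (not_lt.2 this)

theorem clarke_lower (h : PMHyp φ0 φc lam) {x d : EuclideanSpace ℝ (Fin n)} {c : ℝ} {y}
    (hy : y ∈ solSet φ0 φc x) (hc : c < ⟪pmV φ0 φc x y (lam x), d⟫) :
    ∀ᶠ t : ℝ in 𝓝[>] (0 : ℝ), c ≤ (margVal φ0 φc (x + t • d) - margVal φ0 φc x) / t := by
  by_contra hcon
  have hpos : ∀ᶠ t : ℝ in 𝓝[>] (0 : ℝ), 0 < t := self_mem_nhdsWithin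
  obtain ⟨ts, hts, hp⟩ := exists_seq_forall_of_frequently
    ((not_eventually.1 hcon).and_eventually hpos)
  have ht : Tendsto ts atTop (𝓝 0) := hts.mono_right nhdsWithin_le_nhds
  have key : ∀ k, ∃ s ∈ Set.Ioo 0 (ts k), ⟪pmV φ0 φc (x + s • d) y
      (lam (x + ts k • d)), d⟫ ≤ c := by
    intro k
    obtain ⟨s, hs, he⟩ := h.mvt x d y (lam (x + ts k • d)) (hp k).2
    refine ⟨s, hs, ?_⟩
    rw [he]
    refine le_trans ?_ (not_le.1 (hp k).1).le
    have h1 := h.lam_le (x + ts k • d) y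
    have h2 := feas_le_lagr (φ0 := φ0) hy.1 (h.lam_mem (x + ts k • d)).1
    rw [← marg_eq hy] at h2
    exact div_le_div_of_nonneg_right (by linarith) (hp k).2.le
  choose s hs hcs using key
  have hst : Tendsto s atTop (𝓝 0) :=
    tendsto_of_tendsto_of_tendsto_of_le_of_le tendsto_const_nhds ht
      (fun k => (hs k).1.le) (fun k => (hs k).2.le)
  have hadd : ∀ {u : ℕ → ℝ}, Tendsto u atTop (𝓝 0) →
      Tendsto (fun k => x + u k • d) atTop (𝓝 x) := by
    intro u hu
    simpa using (tendsto_const_nhds (x := x)).add (hu.smul_const d)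
  have hV := h.tendsV (hadd hst) (tendsto_const_nhds (x := y)) ((h.lam_tendsto x).comp (hadd ht))
  have := le_of_tendsto' (hV.inner (tendsto_const_nhds (x := d))) hcs
  exact absurd hc (not_lt.2 this)

theorem clarke_freq (h : PMHyp φ0 φc lam) {x d : EuclideanSpace ℝ (Fin n)} {c : ℝ} {y}
    (hy : y ∈ solSet φ0 φc x) (hc : c < ⟪pmV φ0 φc x y (lam x), d⟫) :
    ∃ᶠ p : EuclideanSpace ℝ (Fin n) × ℝ in (𝓝 x) ×ˢ (𝓝[>] (0 : ℝ)),
      c ≤ (margVal φ0 φc (p.1 + p.2 • d) - margVal φ0 φc p.1) / p.2 := by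
  have ht : Tendsto (fun t : ℝ => (x, t)) (𝓝[>] 0) ((𝓝 x) ×ˢ (𝓝[>] (0 : ℝ))) :=
    tendsto_const_nhds.prodMk tendsto_id
  exact ht.frequently (h.clarke_lower hy hc).frequently

theorem clarke_le (h : PMHyp φ0 φc lam) {x d : EuclideanSpace ℝ (Fin n)} {c : ℝ}
    (hc : ∀ y ∈ solSet φ0 φc x, ⟪pmV φ0 φc x y (lam x), d⟫ < c) :
    clarkeDeriv (margVal φ0 φc) x d ≤ c := by
  obtain ⟨y, hy⟩ := h.sol_nonempty x
  have hf := h.clarke_freq (d := d) hy (sub_one_lt _)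
  exact limsup_le_of_le (IsCoboundedUnder.of_frequently_ge hf) (h.clarke_upper hc)

theorem contVy (h : PMHyp φ0 φc lam) (x) (l : Fin r → ℝ) :
    Continuous (fun y => pmV φ0 φc x y l) :=
  continuous_iff_continuousAt.2 fun _ =>
    h.tendsV tendsto_const_nhds tendsto_id tendsto_const_nhds

theorem le_clarke (h : PMHyp φ0 φc lam) {x d : EuclideanSpace ℝ (Fin n)} {y}
    (hy : y ∈ solSet φ0 φc x) :
    ⟪pmV φ0 φc x y (lam x), d⟫ ≤ clarkeDeriv (margVal φ0 φc) x d := by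
  obtain ⟨K, hK⟩ := (h.feas_compact x).exists_bound_of_continuousOn
    (f := fun y => ⟪pmV φ0 φc x y (lam x), d⟫)
    ((h.contVy x (lam x)).inner continuous_const).continuousOn
  have hb := h.clarke_upper (x := x) (d := d) (c := K + 1) (fun z hz => by
    have := (le_abs_self _).trans (hK z hz.1)
    linarith)
  refine le_of_forall_lt_imp_le_of_dense fun c hc => ?_
  exact le_limsup_of_frequently_le (h.clarke_freq hy hc) ⟨K + 1, hb⟩

theorem mem_clarke (h : PMHyp φ0 φc lam) {x y} (hy : y ∈ solSet φ0 φc x) :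
    pmV φ0 φc x y (lam x) ∈ clarkeSubdiff (margVal φ0 φc) x := fun _ => h.le_clarke hy

theorem V_affine (h : PMHyp φ0 φc lam) (x) (l : Fin r → ℝ) :
    ∃ (T : EuclideanSpace ℝ (Fin m) →L[ℝ] EuclideanSpace ℝ (Fin n))
      (b : EuclideanSpace ℝ (Fin n)), ∀ y, pmV φ0 φc x y l = T y + b := by
  obtain ⟨T0, b0, h0⟩ := h.haff0 x
  choose T b hTb using fun j => h.haffc j x
  refine ⟨T0 - ∑ j, l j • T j, b0 - ∑ j, l j • b j, fun y => ?_⟩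
  have d0 : DifferentiableAt ℝ (fun x' => φ0 x' y) x :=
    ((h.hs0.comp (contDiff_id.prodMk contDiff_const :
      ContDiff ℝ 1 fun x' => (x', y))).differentiable (by simp)) x
  have dc : ∀ j, DifferentiableAt ℝ (fun x' => φc j x' y) x := fun j =>
    (((h.hsc j).comp (contDiff_id.prodMk contDiff_const :
      ContDiff ℝ 1 fun x' => (x', y))).differentiable (by simp)) x
  have e0 := d0.hasGradientAt.hasFDerivAt
  have ec := fun j => (dc j).hasGradientAt.hasFDerivAt
  have e : HasGradientAt (fun x' => lagr φ0 φc x' y l)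
      (gradient (fun x' => φ0 x' y) x - ∑ j, l j • gradient (fun x' => φc j x' y) x) x := by
    rw [hasGradientAt_iff_hasFDerivAt, map_sub, map_sum]
    refine e0.sub (HasFDerivAt.fun_sum fun j _ => ?_)
    simpa using (ec j).const_mul (l j)
  unfold pmV
  rw [e.gradient, h0 y]
  simp only [hTb, smul_add, Finset.sum_add_distrib, sub_apply,
    sum_apply, smul_apply]
  abel

theorem sol_convex (h : PMHyp φ0 φc lam) (x) : Convex ℝ (solSet φ0 φc x) := by
  intro y hy z hz a b ha hb hab
  refine ⟨fun j => ?_, fun w hw => ?_⟩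
  · have h1 := (h.hconv j x).2 (mem_univ y) (mem_univ z) ha hb hab
    simp only [smul_eq_mul] at h1
    have h2 := mul_nonpos_of_nonneg_of_nonpos ha (hy.1 j)
    have h3 := mul_nonpos_of_nonneg_of_nonpos hb (hz.1 j)
    linarith
  · have h1 := (h.hconc x).2 (mem_univ y) (mem_univ z) ha hb hab
    simp only [smul_eq_mul] at h1
    have h2 := mul_le_mul_of_nonneg_left (hy.2 w hw) ha
    have h3 := mul_le_mul_of_nonneg_left (hz.2 w hw) hb
    have : φ0 x w = a * φ0 x w + b * φ0 x w := by rw [← add_mul, hab, one_mul]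
    linarith

theorem reg_limit (h : PMHyp φ0 φc lam)
    {xs : ℕ → EuclideanSpace ℝ (Fin n)} {ys : ℕ → EuclideanSpace ℝ (Fin m)} {x y}
    {eps : ℕ → ℝ} {e : ℝ}
    (hx : Tendsto xs atTop (𝓝 x)) (hy : Tendsto ys atTop (𝓝 y)) (he : Tendsto eps atTop (𝓝 e))
    (hf : ∀ k, ys k ∈ regSolLICQ φ0 φc lam (eps k) (xs k)) : y ∈ regSolLICQ φ0 φc lam e x := by
  have hl := (h.lam_tendsto x).comp hx
  refine ⟨h.feas_limit hx hy (fun k => (hf k).1), ?_⟩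
  refine h.argmax_limit (xs := xs) (ys := ys)
    (Ψ := fun k z => φ0 (xs k) z - eps k / 2 * ‖pmV φ0 φc (xs k) z (lam (xs k))‖ ^ 2)
    (Ψ' := fun z => φ0 x z - e / 2 * ‖pmV φ0 φc x z (lam x)‖ ^ 2) hx ?_ ?_ ?_
    (fun k => (hf k).2)
  · exact (h.cont0.comp (Continuous.prodMk_right x)).sub
      (continuous_const.mul ((h.contVy x (lam x)).norm.pow 2))
  · intro z
    exact (h.tends0 hx tendsto_const_nhds).sub
      ((he.div_const 2).mul ((h.tendsV hx tendsto_const_nhds hl).norm.pow 2))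
  · exact (h.tends0 hx hy).sub
      ((he.div_const 2).mul ((h.tendsV hx hy hl).norm.pow 2))

theorem reg_zero (x) : regSolLICQ φ0 φc lam 0 x = solSet φ0 φc x := by
  simp [regSolLICQ, solSet]

theorem reg_compact (h : PMHyp φ0 φc lam) (e : ℝ) (x) :
    IsCompact (regSolLICQ φ0 φc lam e x) := by
  refine (h.feas_compact x).of_isClosed_subset ?_ (fun y hy => hy.1)
  refine IsSeqClosed.isClosed fun ys y hys hy => ?_
  exact h.reg_limit (xs := fun _ => x) (eps := fun _ => e) tendsto_const_nhds hy
    tendsto_const_nhds hys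

theorem reg_nonempty (h : PMHyp φ0 φc lam) (e : ℝ) (x) :
    (regSolLICQ φ0 φc lam e x).Nonempty := by
  obtain ⟨y, hy, hm⟩ := (h.feas_compact x).exists_isMaxOn (h.hne x)
    (f := fun z => φ0 x z - e / 2 * ‖pmV φ0 φc x z (lam x)‖ ^ 2)
    ((h.cont0.comp (Continuous.prodMk_right x)).sub
      (continuous_const.mul ((h.contVy x (lam x)).norm.pow 2))).continuousOn
  exact ⟨y, hy, fun y' hy' => hm hy'⟩

theorem V_bdd (h : PMHyp φ0 φc lam) (x) :
    ∃ B, ∀ᶠ x' in 𝓝 x, ∀ y ∈ feasSet φc x', ‖pmV φ0 φc x' y (lam x')‖ ≤ B := by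
  obtain ⟨δ, hδ, M, hM⟩ := h.hlocbdd x
  obtain ⟨b, hb⟩ := h.lam_bdd x
  obtain ⟨K, hK⟩ := ((isCompact_closedBall x δ).prod
    ((isCompact_closedBall (0 : EuclideanSpace ℝ (Fin m)) M).prod
      (isCompact_Icc (a := (0 : Fin r → ℝ)) (b := b)))).exists_bound_of_continuousOn
      h.contV.continuousOn
  refine ⟨K, ?_⟩
  filter_upwards [Metric.ball_mem_nhds x hδ, hb] with x' hx' hb' y hy
  have h1 := hM x' (mem_ball_iff_norm.1 hx') y hy
  exact hK (x', y, lam x') ⟨Metric.ball_subset_closedBall hx', by simpa using h1, hb'⟩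

theorem joint_limit (h : PMHyp φ0 φc lam) {xs : ℕ → EuclideanSpace ℝ (Fin n)}
    {vs : ℕ → EuclideanSpace ℝ (Fin n)} {x v} {eps : ℕ → ℝ} {e : ℝ}
    (hx : Tendsto xs atTop (𝓝 x)) (he : Tendsto eps atTop (𝓝 e))
    (hv : ∀ k, vs k ∈ GLICQ φ0 φc lam (xs k) (eps k)) (hvt : Tendsto vs atTop (𝓝 v)) :
    v ∈ GLICQ φ0 φc lam x e := by
  choose ys hys hyv using hv
  obtain ⟨y, -, θ, hθ, hy⟩ := h.feas_subseq hx (fun k => (hys k).1)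
  have hx' := hx.comp hθ.tendsto_atTop
  refine ⟨y, h.reg_limit hx' hy (he.comp hθ.tendsto_atTop) (fun k => hys (θ k)), ?_⟩
  have h1 := h.tendsV hx' hy ((h.lam_tendsto x).comp hx')
  refine tendsto_nhds_unique h1 ?_
  refine (hvt.comp hθ.tendsto_atTop).congr fun k => ?_
  exact (hyv (θ k)).symm

theorem descent (h : PMHyp φ0 φc lam) :
    IsDescentOrientedSubdiff (margVal φ0 φc) (GLICQ φ0 φc lam) := by
  have outer : ∀ xbar, SeqJointLimsup (GLICQ φ0 φc lam) xbar ⊆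
      clarkeSubdiff (margVal φ0 φc) xbar := by
    rintro x u ⟨eps, xs, vs, -, he, hx, hv, hvt⟩
    obtain ⟨y, hy, rfl⟩ := h.joint_limit hx he hv hvt
    rw [reg_zero] at hy
    exact h.mem_clarke hy
  refine ⟨fun ε _ x => ?_, fun ε _ x => ?_, outer, fun x => ?_⟩
  · exact ((h.reg_compact ε x).image (h.contVy x (lam x))).isClosed
  · obtain ⟨B, hB⟩ := h.V_bdd x
    obtain ⟨δ, hδ, hB⟩ := Metric.eventually_nhds_iff.1 hB
    refine ⟨δ, hδ, B, ?_⟩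
    rintro x' hx' _ ⟨y, hy, rfl⟩
    exact hB (by simpa [dist_eq_norm] using hx') y hy.1
  · obtain ⟨T, b, hT⟩ := h.V_affine x (lam x)
    have hCcomp : IsCompact ((fun y => pmV φ0 φc x y (lam x)) '' solSet φ0 φc x) := by
      rw [← reg_zero (lam := lam)]
      exact (h.reg_compact 0 x).image (h.contVy x (lam x))
    have hCconv : Convex ℝ ((fun y => pmV φ0 φc x y (lam x)) '' solSet φ0 φc x) := by
      rintro _ ⟨y, hy, rfl⟩ _ ⟨z, hz, rfl⟩ p q hp hq hpq
      refine ⟨p • y + q • z, h.sol_convex x hy hz hp hq hpq, ?_⟩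
      have hbb : b = p • b + q • b := by rw [← add_smul, hpq, one_smul]
      simp only [hT, map_add, map_smul, smul_add]
      nth_rewrite 1 [hbb]
      abel
    obtain ⟨g, hg, hgmin⟩ := exists_norm_eq_iInf_of_complete_convex
      ((h.sol_nonempty x).image _) hCcomp.isComplete hCconv 0
    rw [norm_eq_iInf_iff_real_inner_le_zero hCconv hg] at hgmin
    have hgC : ∀ y ∈ solSet φ0 φc x, ⟪pmV φ0 φc x y (lam x), -g⟫ ≤ -‖g‖ ^ 2 := by
      intro y hy
      have := hgmin _ ⟨y, hy, rfl⟩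
      simp only [zero_sub, inner_neg_left, inner_sub_right, real_inner_self_eq_norm_sq] at this
      rw [inner_neg_right, real_inner_comm]
      linarith
    have hv : ∀ v ∈ clarkeSubdiff (margVal φ0 φc) x, ‖g‖ ^ 2 ≤ ⟪v, g⟫ := by
      intro v hv
      have h1 : ∀ η : ℝ, 0 < η → ⟪v, -g⟫ ≤ -‖g‖ ^ 2 + η := fun η hη =>
        (hv (-g)).trans (h.clarke_le fun y hy => by linarith [hgC y hy])
      have h2 := le_of_forall_pos_le_add h1
      rw [inner_neg_right] at h2
      linarith
    have hgmem : g ∈ clarkeSubdiff (margVal φ0 φc) x := by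
      obtain ⟨y, hy, rfl⟩ := hg
      exact h.mem_clarke hy
    have huniq : ∀ v ∈ clarkeSubdiff (margVal φ0 φc) x, ‖v‖ ≤ ‖g‖ → v = g := by
      intro v hvm hle
      have h1 := hv v hvm
      have h2 : ‖v - g‖ ^ 2 = ‖v‖ ^ 2 - 2 * ⟪v, g⟫ + ‖g‖ ^ 2 := norm_sub_sq_real v g
      have h3 : ‖v‖ ^ 2 ≤ ‖g‖ ^ 2 := pow_le_pow_left₀ (norm_nonneg _) hle 2
      have h4 : ‖v - g‖ ^ 2 = 0 := le_antisymm (by linarith) (sq_nonneg _)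
      exact sub_eq_zero.1 (norm_eq_zero.1 (pow_eq_zero_iff (two_ne_zero)|>.1 h4))
    have hGnorm : ∀ ε : ℝ, 0 < ε → ∀ v ∈ GLICQ φ0 φc lam x ε, ‖v‖ ≤ ‖g‖ := by
      rintro ε hε _ ⟨y, hy, rfl⟩
      obtain ⟨z, hz, rfl⟩ := hg
      have h1 := hy.2 z hz.1
      have h2 := hz.2 y hy.1
      change φ0 x z - ε / 2 * ‖pmV φ0 φc x z (lam x)‖ ^ 2 ≤
        φ0 x y - ε / 2 * ‖pmV φ0 φc x y (lam x)‖ ^ 2 at h1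
      have h3 : ε / 2 * ‖pmV φ0 φc x y (lam x)‖ ^ 2 ≤ ε / 2 * ‖pmV φ0 φc x z (lam x)‖ ^ 2 := by
        linarith
      have h4 := le_of_mul_le_mul_left h3 (by linarith)
      exact le_of_sq_le_sq h4 (norm_nonneg _)
    have hlim : ∀ (eps : ℕ → ℝ) (vs : ℕ → EuclideanSpace ℝ (Fin n)) u, (∀ k, 0 < eps k) →
        Tendsto eps atTop (𝓝 0) → (∀ k, vs k ∈ GLICQ φ0 φc lam x (eps k)) →
        Tendsto vs atTop (𝓝 u) → u = g := by
      intro eps vs u hpos he hvs hu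
      refine huniq u (outer x ⟨eps, fun _ => x, vs, hpos, he, tendsto_const_nhds, hvs, hu⟩) ?_
      exact le_of_tendsto' hu.norm fun k => hGnorm _ (hpos k) _ (hvs k)
    refine ⟨g, ⟨hgmem, fun v hvm => ?_⟩, ?_, ?_⟩
    · have h1 := hv v hvm
      have h2 := real_inner_le_norm v g
      by_contra hlt
      have hlt := not_le.1 hlt
      nlinarith [norm_nonneg v, norm_nonneg g]
    · rintro u ⟨eps, vs, hpos, he, hvs, hu⟩
      refine hlim eps vs u hpos he (fun k => ?_) hu
      obtain ⟨xs, ws, hxs, hws, hwt⟩ := hvs k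
      exact h.joint_limit (eps := fun _ => eps k) hxs tendsto_const_nhds hws hwt
    · rintro u hu eps hpos he
      rw [mem_singleton_iff] at hu
      subst hu
      choose ys hys using fun k => h.reg_nonempty (eps k) x
      have hG : ∀ k, pmV φ0 φc x (ys k) (lam x) ∈ GLICQ φ0 φc lam x (eps k) :=
        fun k => ⟨ys k, hys k, rfl⟩
      refine ⟨fun k => pmV φ0 φc x (ys k) (lam x), Eventually.of_forall fun k => ?_, ?_⟩
      · exact ⟨fun _ => x, fun _ => pmV φ0 φc x (ys k) (lam x), tendsto_const_nhds,
          fun _ => hG k, tendsto_const_nhds⟩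
      · refine tendsto_of_subseq_tendsto fun ns hns => ?_
        obtain ⟨w, -, θ, hθ, hw⟩ := tendsto_subseq_of_bounded
          (Metric.isBounded_closedBall (x := (0 : EuclideanSpace ℝ (Fin n))) (r := ‖u‖))
          (x := fun k => pmV φ0 φc x (ys (ns k)) (lam x))
          (fun k => by simpa using hGnorm _ (hpos (ns k)) _ (hG (ns k)))
        have hwu := hlim (fun k => eps (ns (θ k))) _ w (fun k => hpos _)
          (he.comp (hns.comp hθ.tendsto_atTop)) (fun k => hG (ns (θ k))) hw
        exact ⟨θ, by rw [← hwu]; exact hw⟩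

end PMHyp

/-- Case 1: LICQ and affine `∇ₓφ_j(x, ·)`: the subgradient-regularized
map `G` of (4.7) is a descent-oriented subdifferential for the marginal function `f`. -/
theorem param_marginal_LICQ_descentOriented {n m r : ℕ}
    (φ0 : EuclideanSpace ℝ (Fin n) → EuclideanSpace ℝ (Fin m) → ℝ)
    (φc : Fin r → EuclideanSpace ℝ (Fin n) → EuclideanSpace ℝ (Fin m) → ℝ)
    (hs0 : ContDiff ℝ 1 fun p : EuclideanSpace ℝ (Fin n) × EuclideanSpace ℝ (Fin m) => φ0 p.1 p.2)
    (hsc : ∀ j, ContDiff ℝ 1 fun p : EuclideanSpace ℝ (Fin n) × EuclideanSpace ℝ (Fin m) => φc j p.1 p.2)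
    (hconc : ∀ x, ConcaveOn ℝ Set.univ (φ0 x))
    (hconv : ∀ j x, ConvexOn ℝ Set.univ (φc j x))
    (hne : ∀ x, (feasSet φc x).Nonempty)
    (hlocbdd : ∀ x : EuclideanSpace ℝ (Fin n), ∃ δ > (0 : ℝ), ∃ M : ℝ,
      ∀ x' : EuclideanSpace ℝ (Fin n), ‖x' - x‖ < δ → ∀ y ∈ feasSet φc x', ‖y‖ ≤ M)
    (hMFCQ : ∀ x, ∀ y ∈ solSet φ0 φc x, ∃ w : EuclideanSpace ℝ (Fin m),
      ∀ j, φc j x y = 0 → ⟪gradient (fun y' => φc j x y') y, w⟫ < 0)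
    (hLICQ : ∀ x, ∀ y ∈ solSet φ0 φc x,
      LinearIndependent ℝ (fun j : {j : Fin r // φc j x y = 0} =>
        gradient (fun y' => φc j.1 x y') y))
    (lam : EuclideanSpace ℝ (Fin n) → Fin r → ℝ)
    (hlam : ∀ x, multSet φ0 φc x = {lam x})
    (haff0 : ∀ x : EuclideanSpace ℝ (Fin n),
      ∃ (T : EuclideanSpace ℝ (Fin m) →L[ℝ] EuclideanSpace ℝ (Fin n))
        (b : EuclideanSpace ℝ (Fin n)),
        ∀ y, gradient (fun x' => φ0 x' y) x = T y + b)
    (haffc : ∀ (j : Fin r) (x : EuclideanSpace ℝ (Fin n)),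
      ∃ (T : EuclideanSpace ℝ (Fin m) →L[ℝ] EuclideanSpace ℝ (Fin n))
        (b : EuclideanSpace ℝ (Fin n)),
        ∀ y, gradient (fun x' => φc j x' y) x = T y + b) :
    IsDescentOrientedSubdiff (margVal φ0 φc) (GLICQ φ0 φc lam) := by
  exact PMHyp.descent
    ⟨hs0, hsc, hconc, hconv, hne, hlocbdd, hMFCQ, hlam, haff0, haffc⟩
end
end

section
/- Consider the composite function f = h ∘ c and let {x_k} be an (infinite) sequence generated by Algorithm 2 with G defined via subgradient regularization. Suppose: the level set X = {x ∈ ℝⁿ : f(x) ≤ f(x_0)} is compact; ∂f is metrically subregular at (x̄, 0) for every stationary point x̄ ∈ (∂f)⁻¹(0) ∩ X; and there exists δ₀ > 0 such that any two stationary points x, y of f with f(x) ≠ f(y) satisfy ‖x − y‖ ≥ δ₀. Then the iterates converge to a stationary point x̄ and, for all sufficiently large k, both the function values and the iterates converge linearly: there exist q ∈ (0,1), C > 0, and an index r such that f(x_{k+1}) − f(x̄) ≤ q·(f(x_k) − f(x̄)) for all k ≥ r and ‖x_k − x̄‖ ≤ C·q^{k/2} for all k ≥ r. -/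
open Filter Topology Set
open scoped RealInnerProductSpace NNReal

noncomputable section

variable {E : Type*} [NormedAddCommGroup E] [InnerProductSpace ℝ E]

/-- The Armijo-type descent test at iteration `k`, inner index `i`, stepsize index `j`:
`f (x_k - (ε_{k,0} 2^{-j}) g^{k,i}) ≤ f (x_k) - α ε_{k,0} 2^{-j} ‖g^{k,i}‖²`. -/
def DescStep (f : E → ℝ) (α : ℝ) (xs : ℕ → E) (eps0 : ℕ → ℝ) (gsel : ℕ → ℕ → E)
    (k i j : ℕ) : Prop :=
  f (xs k - (eps0 k / 2 ^ j) • gsel k i) ≤ f (xs k) - α * (eps0 k / 2 ^ j) * ‖gsel k i‖ ^ 2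

/-- The inner loop terminates at iteration `k`. -/
def InnerTerminates (f : E → ℝ) (α : ℝ) (xs : ℕ → E) (eps0 : ℕ → ℝ)
    (gsel : ℕ → ℕ → E) (k : ℕ) : Prop :=
  ∃ i, ∃ j ≤ i, DescStep f α xs eps0 gsel k i j

/-- The subdifferential (in the sense of convex analysis) of `h` at `u`. -/
def convexSubdiff {m : ℕ} (h : EuclideanSpace ℝ (Fin m) → ℝ)
    (u : EuclideanSpace ℝ (Fin m)) : Set (EuclideanSpace ℝ (Fin m)) :=
  {v | ∀ z, h u + ⟪v, z - u⟫ ≤ h z}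

/-- `∇c(x)`, the transpose (adjoint) of the Jacobian of `c` at `x`, acting `ℝᵐ → ℝⁿ`. -/
def nablaC {n m : ℕ}
    (c' : EuclideanSpace ℝ (Fin n) → (EuclideanSpace ℝ (Fin n) →L[ℝ] EuclideanSpace ℝ (Fin m)))
    (x : EuclideanSpace ℝ (Fin n)) :
    EuclideanSpace ℝ (Fin m) →L[ℝ] EuclideanSpace ℝ (Fin n) :=
  ContinuousLinearMap.adjoint (c' x)

/-- The Clarke subdifferential of the composite `f = h ∘ c`:  `∂f(x) = ∇c(x) ∂h(c(x))`. -/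
def compSubdiff {n m : ℕ} (c : EuclideanSpace ℝ (Fin n) → EuclideanSpace ℝ (Fin m))
    (c' : EuclideanSpace ℝ (Fin n) → (EuclideanSpace ℝ (Fin n) →L[ℝ] EuclideanSpace ℝ (Fin m)))
    (h : EuclideanSpace ℝ (Fin m) → ℝ) (x : EuclideanSpace ℝ (Fin n)) :
    Set (EuclideanSpace ℝ (Fin n)) :=
  (fun v => nablaC c' x v) '' convexSubdiff h (c x)

/-- `y` belongs to the effective domain of the Fenchel conjugate `h*`. -/
def inDomStar {m : ℕ} (h : EuclideanSpace ℝ (Fin m) → ℝ)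
    (y : EuclideanSpace ℝ (Fin m)) : Prop :=
  BddAbove (Set.range fun z => ⟪y, z⟫ - h z)

/-- The Fenchel conjugate `h*(y) = sup_z {⟨y, z⟩ − h(z)}` (real-valued on its domain). -/
def fenchelConj {m : ℕ} (h : EuclideanSpace ℝ (Fin m) → ℝ)
    (y : EuclideanSpace ℝ (Fin m)) : ℝ :=
  ⨆ z, (⟪y, z⟫ - h z)

/-- The dual regularized solution set
`Y^ε(x) = argmax_y {yᵀc(x) − h*(y) − (ε/2)‖∇c(x) y‖²}`
(the maximization being over the effective domain of `h*`). -/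
def regDual {n m : ℕ} (c : EuclideanSpace ℝ (Fin n) → EuclideanSpace ℝ (Fin m))
    (c' : EuclideanSpace ℝ (Fin n) → (EuclideanSpace ℝ (Fin n) →L[ℝ] EuclideanSpace ℝ (Fin m)))
    (h : EuclideanSpace ℝ (Fin m) → ℝ) (ε : ℝ) (x : EuclideanSpace ℝ (Fin n)) :
    Set (EuclideanSpace ℝ (Fin m)) :=
  {y | inDomStar h y ∧ ∀ y', inDomStar h y' →
    ⟪y', c x⟫ - fenchelConj h y' - ε / 2 * ‖nablaC c' x y'‖ ^ 2 ≤
      ⟪y, c x⟫ - fenchelConj h y - ε / 2 * ‖nablaC c' x y‖ ^ 2}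

/-- The subgradient-regularized map `G(x, ε) = {∇c(x) y : y ∈ Y^ε(x)}`. -/
def Gcomp {n m : ℕ} (c : EuclideanSpace ℝ (Fin n) → EuclideanSpace ℝ (Fin m))
    (c' : EuclideanSpace ℝ (Fin n) → (EuclideanSpace ℝ (Fin n) →L[ℝ] EuclideanSpace ℝ (Fin m)))
    (h : EuclideanSpace ℝ (Fin m) → ℝ) (x : EuclideanSpace ℝ (Fin n)) (ε : ℝ) :
    Set (EuclideanSpace ℝ (Fin n)) :=
  (fun y => nablaC c' x y) '' regDual c c' h ε x

/-- The prox-linear objective `z ↦ h(c(x) + ∇c(x)ᵀ(z − x)) + ‖z − x‖²/(2ε)`. -/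
def proxObj {n m : ℕ} (c : EuclideanSpace ℝ (Fin n) → EuclideanSpace ℝ (Fin m))
    (c' : EuclideanSpace ℝ (Fin n) → (EuclideanSpace ℝ (Fin n) →L[ℝ] EuclideanSpace ℝ (Fin m)))
    (h : EuclideanSpace ℝ (Fin m) → ℝ) (ε : ℝ) (x z : EuclideanSpace ℝ (Fin n)) : ℝ :=
  h (c x + (c' x) (z - x)) + ‖z - x‖ ^ 2 / (2 * ε)

section Helpers

theorem aux_taylor {n m : ℕ}
    {c : EuclideanSpace ℝ (Fin n) → EuclideanSpace ℝ (Fin m)}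
    {cp : EuclideanSpace ℝ (Fin n) → (EuclideanSpace ℝ (Fin n) →L[ℝ] EuclideanSpace ℝ (Fin m))}
    {β : ℝ≥0} (hc : ∀ x, HasFDerivAt c (cp x) x) (hβ : LipschitzWith β cp)
    (x w : EuclideanSpace ℝ (Fin n)) :
    ‖c w - c x - cp x (w - x)‖ ≤ β * ‖w - x‖ ^ 2 := by
  have := (convex_closedBall x ‖w - x‖).norm_image_sub_le_of_norm_hasFDerivWithin_le'
    (f := c) (f' := cp) (φ := cp x) (C := β * ‖w - x‖) (x := x) (y := w)
    (fun z _ => (hc z).hasFDerivWithinAt)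
    (fun z hz => by
      have h1 := hβ.norm_sub_le z x
      rw [mem_closedBall_iff_norm] at hz
      exact h1.trans (by gcongr))
    (Metric.mem_closedBall_self (norm_nonneg _)) (by simp [dist_eq_norm])
  rw [pow_two, ← mul_assoc]; exact this

theorem aux_model {n m : ℕ}
    {c : EuclideanSpace ℝ (Fin n) → EuclideanSpace ℝ (Fin m)}
    {cp : EuclideanSpace ℝ (Fin n) → (EuclideanSpace ℝ (Fin n) →L[ℝ] EuclideanSpace ℝ (Fin m))}
    {β : ℝ≥0} (hc : ∀ x, HasFDerivAt c (cp x) x) (hβ : LipschitzWith β cp)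
    {h : EuclideanSpace ℝ (Fin m) → ℝ} {L : ℝ≥0} (hL : LipschitzWith L h)
    (x w : EuclideanSpace ℝ (Fin n)) :
    |h (c w) - h (c x + cp x (w - x))| ≤ L * β * ‖w - x‖ ^ 2 := by
  have h1 := hL.norm_sub_le (c w) (c x + cp x (w - x))
  rw [Real.norm_eq_abs] at h1
  have h2 := aux_taylor hc hβ x w
  rw [← sub_sub] at h1
  calc _ ≤ _ := h1
    _ ≤ L * (β * ‖w - x‖ ^ 2) := by gcongr
    _ = _ := by ring

theorem aux_norm_le {m : ℕ} {h : EuclideanSpace ℝ (Fin m) → ℝ} {L : ℝ≥0}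
    (hL : LipschitzWith L h) {u v : EuclideanSpace ℝ (Fin m)} (hv : v ∈ convexSubdiff h u) :
    ‖v‖ ≤ L := by
  have h1 := hv (u + v)
  rw [add_sub_cancel_left, real_inner_self_eq_norm_sq] at h1
  have h2 := hL.norm_sub_le (u + v) u
  rw [add_sub_cancel_left, Real.norm_eq_abs] at h2
  have h3 := (le_abs_self _).trans h2
  by_contra hcon
  push Not at hcon
  have : 0 < ‖v‖ := lt_of_le_of_lt L.2 hcon
  nlinarith

theorem aux_hahn {n m : ℕ} {h : EuclideanSpace ℝ (Fin m) → ℝ}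
    (hconv : ConvexOn ℝ Set.univ h) (hcont : Continuous h)
    (A : EuclideanSpace ℝ (Fin n) →L[ℝ] EuclideanSpace ℝ (Fin m))
    (p : EuclideanSpace ℝ (Fin n)) (u0 : EuclideanSpace ℝ (Fin m))
    (H : ∀ d, h u0 + ⟪p, d⟫ ≤ h (u0 + A d)) :
    ∃ v ∈ convexSubdiff h u0, ContinuousLinearMap.adjoint A v = p := by
  set s : Set (EuclideanSpace ℝ (Fin m) × ℝ) := {q | q.1 ∈ (Set.univ : Set _) ∧ h q.1 < q.2} with hs
  set t : Set (EuclideanSpace ℝ (Fin m) × ℝ) := Set.range fun d => (u0 + A d, h u0 + ⟪p, d⟫) with ht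
  have hsconv : Convex ℝ s := hconv.convex_strict_epigraph
  have hsopen : IsOpen s := by
    simp only [hs, Set.mem_univ, true_and]
    exact isOpen_lt (hcont.comp continuous_fst) continuous_snd
  have htconv : Convex ℝ t := by
    rintro _ ⟨d, rfl⟩ _ ⟨e, rfl⟩ a b ha hb hab
    refine ⟨a • d + b • e, ?_⟩
    have hb' : b = 1 - a := by linarith
    ext1
    · simp [map_add, map_smul, hb']; module
    · simp [inner_add_right, inner_smul_right, hb']; ring
  have hdisj : Disjoint s t := by
    rw [Set.disjoint_left]
    rintro _ ⟨_, h1⟩ ⟨d, rfl⟩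
    exact absurd (H d) (not_le.2 h1)
  obtain ⟨F, b, hF1, hF2⟩ := geometric_hahn_banach_open hsconv hsopen htconv hdisj
  set σ : ℝ := F (0, 1) with hσ
  have hFr : ∀ r : ℝ, F (0, r) = r * σ := by
    intro r
    have : ((0 : EuclideanSpace ℝ (Fin m)), r) = r • ((0 : EuclideanSpace ℝ (Fin m)), (1:ℝ)) := by
      ext1 <;> simp
    rw [this, map_smul, smul_eq_mul]
  set w := (InnerProductSpace.toDual ℝ (EuclideanSpace ℝ (Fin m))).symm
    (F.comp (ContinuousLinearMap.inl ℝ _ ℝ)) with hw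
  have hFw : ∀ u, F (u, 0) = ⟪w, u⟫ := by
    intro u
    rw [hw, InnerProductSpace.toDual_symm_apply]; simp
  have hF : ∀ u r, F (u, r) = ⟪w, u⟫ + r * σ := by
    intro u r
    rw [← hFw, ← hFr, ← map_add]; simp
  have h1 : ∀ u r, h u < r → ⟪w, u⟫ + r * σ < b := fun u r hr => by
    rw [← hF]; exact hF1 _ ⟨Set.mem_univ _, hr⟩
  have h2 : ∀ d, b ≤ ⟪w, u0 + A d⟫ + (h u0 + ⟪p, d⟫) * σ := fun d => by
    rw [← hF]; exact hF2 _ ⟨d, rfl⟩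
  have h20 := h2 0
  simp only [map_zero, add_zero, inner_zero_right] at h20
  have hσneg : σ < 0 := by
    have := h1 u0 (h u0 + 1) (by linarith)
    nlinarith
  have h1' : ∀ u, ⟪w, u⟫ + h u * σ ≤ b := by
    intro u
    apply le_of_forall_pos_lt_add
    intro e he
    have := h1 u (h u + e / (-σ)) (by have := div_pos he (neg_pos.2 hσneg); linarith)
    have h3 : e / (-σ) * σ = - e := by
      have := hσneg.ne
      rw [div_neg, neg_mul, div_mul_cancel₀ _ this]
    nlinarith
  have hbeq : b = ⟪w, u0⟫ + h u0 * σ := le_antisymm h20 (h1' u0)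
  have h4 : ∀ d, 0 ≤ ⟪ContinuousLinearMap.adjoint A w + σ • p, d⟫ := by
    intro d
    have := h2 d
    rw [inner_add_left, ContinuousLinearMap.adjoint_inner_left, inner_smul_left]
    rw [inner_add_right] at this
    simp
    linarith
  have h5 : ContinuousLinearMap.adjoint A w + σ • p = 0 := by
    have := h4 (-(ContinuousLinearMap.adjoint A w + σ • p))
    rw [inner_neg_right, real_inner_self_eq_norm_sq] at this
    have h6 : ‖ContinuousLinearMap.adjoint A w + σ • p‖ ^ 2 = 0 :=
      le_antisymm (by linarith) (sq_nonneg _)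
    exact norm_eq_zero.1 (by simpa using h6)
  refine ⟨(-σ)⁻¹ • w, ?_, ?_⟩
  · intro z
    have := h1' z
    rw [inner_smul_left, inner_sub_right]
    simp only [conj_trivial]
    have h7 : (-σ)⁻¹ * (⟪w, z⟫ - ⟪w, u0⟫) ≤ h z - h u0 := by
      rw [inv_mul_le_iff₀ (neg_pos.2 hσneg)]
      linarith
    linarith
  · rw [map_smul, eq_neg_of_add_eq_zero_left h5, ← neg_smul, smul_smul, inv_mul_cancel₀ (by linarith), one_smul]

theorem aux_regDual {n m : ℕ}
    {c : EuclideanSpace ℝ (Fin n) → EuclideanSpace ℝ (Fin m)}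
    {cp : EuclideanSpace ℝ (Fin n) → (EuclideanSpace ℝ (Fin n) →L[ℝ] EuclideanSpace ℝ (Fin m))}
    {h : EuclideanSpace ℝ (Fin m) → ℝ}
    (hconv : ConvexOn ℝ Set.univ h) (hcont : Continuous h)
    {ε : ℝ} {x : EuclideanSpace ℝ (Fin n)}
    {y : EuclideanSpace ℝ (Fin m)} (hy : y ∈ regDual c cp h ε x) :
    y ∈ convexSubdiff h (c x - ε • cp x (nablaC cp x y)) := by
  obtain ⟨hdom, hmax⟩ := hy
  set g := nablaC cp x y with hg
  set u := c x - ε • cp x g with hu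
  have hconj : ∀ {y'}, inDomStar h y' → ∀ z, ⟪y', z⟫ - h z ≤ fenchelConj h y' :=
    fun hy' z => le_ciSup hy' z
  obtain ⟨y', hy', -⟩ := aux_hahn hconv hcont (0 : EuclideanSpace ℝ (Fin n) →L[ℝ] _) 0 u
    (by intro d; simp)
  have hle' : ∀ z, ⟪y', z⟫ - h z ≤ ⟪y', u⟫ - h u := by
    intro z
    have := hy' z
    rw [inner_sub_right] at this
    linarith
  have hdom' : inDomStar h y' := ⟨_, by rintro _ ⟨z, rfl⟩; exact hle' z⟩
  have hc' : fenchelConj h y' ≤ ⟪y', u⟫ - h u := ciSup_le hle'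
  have key : ∀ t ∈ Set.Ioo (0 : ℝ) 1, ⟪y' - y, u⟫ - (fenchelConj h y' - fenchelConj h y)
      ≤ t * (ε / 2 * ‖nablaC cp x (y' - y)‖ ^ 2) := by
    intro t ht
    have hpt : ∀ z, ⟪y + t • (y' - y), z⟫ - h z ≤
        (1 - t) * fenchelConj h y + t * fenchelConj h y' := by
      intro z
      have e1 := mul_le_mul_of_nonneg_left (hconj hdom z) (sub_nonneg.2 ht.2.le)
      have e2 := mul_le_mul_of_nonneg_left (hconj hdom' z) ht.1.le
      rw [inner_add_left, inner_smul_left, inner_sub_left]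
      simp only [conj_trivial]
      linarith
    have hd : inDomStar h (y + t • (y' - y)) := ⟨_, by rintro _ ⟨z, rfl⟩; exact hpt z⟩
    have hf : fenchelConj h (y + t • (y' - y)) ≤ _ := ciSup_le hpt
    have hm := hmax _ hd
    rw [map_add, map_smul, ← hg, norm_add_sq_real, norm_smul, inner_add_left, inner_smul_left,
      inner_smul_right, mul_pow, Real.norm_eq_abs, sq_abs] at hm
    simp only [conj_trivial] at hm
    have e3 : ⟪y' - y, u⟫ = ⟪y' - y, c x⟫ - ε * ⟪g, nablaC cp x (y' - y)⟫ := by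
      rw [hu, inner_sub_right, inner_smul_right, real_inner_comm (nablaC cp x (y' - y)) g]
      simp only [nablaC]
      rw [ContinuousLinearMap.adjoint_inner_left]
    rw [e3]
    refine le_of_mul_le_mul_left ?_ ht.1
    nlinarith
  have key0 : ⟪y' - y, u⟫ - (fenchelConj h y' - fenchelConj h y) ≤ 0 := by
    set Q := ε / 2 * ‖nablaC cp x (y' - y)‖ ^ 2
    have hlim : Tendsto (fun t : ℝ => t * Q) (𝓝[>] 0) (𝓝 (0 * Q)) :=
      ((continuous_id.mul continuous_const).tendsto (0 : ℝ)).mono_left nhdsWithin_le_nhds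
    rw [zero_mul] at hlim
    refine ge_of_tendsto hlim ?_
    filter_upwards [Ioo_mem_nhdsGT (show (0:ℝ) < 1 by norm_num)] with t ht using key t ht
  intro z
  have e4 := hconj hdom z
  rw [inner_sub_left] at key0
  have e5 := hconj hdom' u
  rw [inner_sub_right]
  linarith

theorem aux_lin {n m : ℕ}
    {c : EuclideanSpace ℝ (Fin n) → EuclideanSpace ℝ (Fin m)}
    {cp : EuclideanSpace ℝ (Fin n) → (EuclideanSpace ℝ (Fin n) →L[ℝ] EuclideanSpace ℝ (Fin m))}
    {h : EuclideanSpace ℝ (Fin m) → ℝ} {ε : ℝ} {x : EuclideanSpace ℝ (Fin n)}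
    {y : EuclideanSpace ℝ (Fin m)}
    (hy : y ∈ convexSubdiff h (c x - ε • cp x (nablaC cp x y))) (w : EuclideanSpace ℝ (Fin n)) :
    h (c x - ε • cp x (nablaC cp x y)) + (⟪nablaC cp x y, w - x⟫ + ε * ‖nablaC cp x y‖ ^ 2)
      ≤ h (c x + cp x (w - x)) := by
  have h1 := hy (c x + cp x (w - x))
  have h2 : c x + cp x (w - x) - (c x - ε • cp x (nablaC cp x y))
      = cp x ((w - x) + ε • nablaC cp x y) := by
    rw [map_add, map_smul]; abel
  rw [h2, ← ContinuousLinearMap.adjoint_inner_left, inner_add_right, inner_smul_right] at h1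
  change _ + (⟪nablaC cp x y, w - x⟫ + ε * ⟪nablaC cp x y, nablaC cp x y⟫) ≤ _ at h1
  rw [real_inner_self_eq_norm_sq] at h1
  exact h1

theorem aux_step_model {n m : ℕ}
    {c : EuclideanSpace ℝ (Fin n) → EuclideanSpace ℝ (Fin m)}
    {cp : EuclideanSpace ℝ (Fin n) → (EuclideanSpace ℝ (Fin n) →L[ℝ] EuclideanSpace ℝ (Fin m))}
    {β : ℝ≥0} (hc : ∀ x, HasFDerivAt c (cp x) x) (hβ : LipschitzWith β cp)
    {h : EuclideanSpace ℝ (Fin m) → ℝ} {L : ℝ≥0} (hL : LipschitzWith L h)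
    (x g : EuclideanSpace ℝ (Fin n)) (ε : ℝ) :
    |h (c (x - ε • g)) - h (c x - ε • cp x g)| ≤ L * β * (ε ^ 2 * ‖g‖ ^ 2) := by
  have h1 := aux_model hc hβ hL x (x - ε • g)
  have h2 : x - ε • g - x = -(ε • g) := by abel
  rw [h2, map_neg, map_smul, norm_neg, norm_smul, mul_pow, Real.norm_eq_abs, sq_abs,
    ← sub_eq_add_neg] at h1
  exact h1

theorem aux_desc {n m : ℕ}
    {c : EuclideanSpace ℝ (Fin n) → EuclideanSpace ℝ (Fin m)}
    {cp : EuclideanSpace ℝ (Fin n) → (EuclideanSpace ℝ (Fin n) →L[ℝ] EuclideanSpace ℝ (Fin m))}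
    {β : ℝ≥0} (hc : ∀ x, HasFDerivAt c (cp x) x) (hβ : LipschitzWith β cp)
    {h : EuclideanSpace ℝ (Fin m) → ℝ} {L : ℝ≥0} (hL : LipschitzWith L h)
    {ε : ℝ} {x : EuclideanSpace ℝ (Fin n)} {y : EuclideanSpace ℝ (Fin m)}
    (hy : y ∈ convexSubdiff h (c x - ε • cp x (nablaC cp x y))) :
    h (c (x - ε • nablaC cp x y)) ≤
      h (c x) - ε * ‖nablaC cp x y‖ ^ 2 + L * β * (ε ^ 2 * ‖nablaC cp x y‖ ^ 2) := by
  have h1 := aux_lin hy x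
  have h2 := (abs_le.1 (aux_step_model hc hβ hL x (nablaC cp x y) ε)).2
  simp at h1
  linarith

theorem aux_small_of_mul {a Q b : ℝ} (H : ∀ t ∈ Set.Ioo (0 : ℝ) 1, a ≤ b + t * Q) : a ≤ b := by
  have hlim : Tendsto (fun t : ℝ => b + t * Q) (𝓝[>] 0) (𝓝 (b + 0 * Q)) :=
    ((continuous_const.add (continuous_id.mul continuous_const)).tendsto (0 : ℝ)).mono_left
      nhdsWithin_le_nhds
  rw [zero_mul, add_zero] at hlim
  refine ge_of_tendsto hlim ?_
  filter_upwards [Ioo_mem_nhdsGT (show (0:ℝ) < 1 by norm_num)] with t ht using H t ht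

theorem aux_prox {n m : ℕ}
    {c : EuclideanSpace ℝ (Fin n) → EuclideanSpace ℝ (Fin m)}
    {cp : EuclideanSpace ℝ (Fin n) → (EuclideanSpace ℝ (Fin n) →L[ℝ] EuclideanSpace ℝ (Fin m))}
    {β : ℝ≥0} (hc : ∀ x, HasFDerivAt c (cp x) x) (hβ : LipschitzWith β cp)
    {h : EuclideanSpace ℝ (Fin m) → ℝ} {L : ℝ≥0}
    (hconv : ConvexOn ℝ Set.univ h) (hL : LipschitzWith L h)
    (hbddh : BddBelow (Set.range h)) {K : ℝ} (hK : 0 < K) (x : EuclideanSpace ℝ (Fin n)) :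
    ∃ z, (∀ w, h (c z) + K * ‖z - x‖ ^ 2 ≤ h (c w) + K * ‖w - x‖ ^ 2) ∧
      (2 * K) • (x - z) ∈ compSubdiff c cp h z := by
  have hcc : Continuous c := continuous_iff_continuousAt.2 fun x => (hc x).continuousAt
  obtain ⟨b, hb⟩ := hbddh
  have hcont : Continuous fun w => h (c w) + K * ‖w - x‖ ^ 2 := by
    have := hL.continuous
    fun_prop
  have htend : Tendsto (fun w => h (c w) + K * ‖w - x‖ ^ 2) (cocompact _) atTop := by
    have h1 : Tendsto (fun w : EuclideanSpace ℝ (Fin n) => ‖w - x‖) (cocompact _) atTop := by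
      simpa [dist_eq_norm] using tendsto_dist_right_cocompact_atTop x
    have h2 : Tendsto (fun w : EuclideanSpace ℝ (Fin n) => b + K * ‖w - x‖ ^ 2) (cocompact _) atTop :=
      tendsto_atTop_add_const_left _ _
        (((tendsto_pow_atTop (two_ne_zero)).comp h1).const_mul_atTop hK)
    refine tendsto_atTop_mono (fun w => ?_) h2
    have := hb ⟨c w, rfl⟩
    linarith
  obtain ⟨z, hz⟩ := hcont.exists_forall_le htend
  refine ⟨z, hz, ?_⟩
  obtain ⟨v, hv, hv2⟩ := aux_hahn hconv hL.continuous (cp z) ((2 * K) • (x - z)) (c z) (by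
    intro d
    rw [inner_smul_left]
    simp only [conj_trivial]
    refine aux_small_of_mul (Q := (L * β + K) * ‖d‖ ^ 2) ?_
    intro t ht
    have h1 := hz (z + t • d)
    have h2 := (abs_le.1 (aux_model hc hβ hL z (z + t • d))).2
    have h3 := hconv.2 (Set.mem_univ (c z)) (Set.mem_univ (c z + cp z d))
      (sub_nonneg.2 ht.2.le) ht.1.le (by ring)
    have h4 : (1 - t) • c z + t • (c z + cp z d) = c z + t • cp z d := by module
    have h5 : z + t • d - x = (z - x) + t • d := by abel
    rw [add_sub_cancel_left, map_smul, norm_smul, mul_pow, Real.norm_eq_abs, sq_abs] at h2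
    rw [h4] at h3
    simp only [smul_eq_mul] at h3
    rw [h5, norm_add_sq_real (z - x), norm_smul, mul_pow, Real.norm_eq_abs, sq_abs,
      inner_smul_right] at h1
    have h6 : ⟪x - z, d⟫ = - ⟪z - x, d⟫ := by rw [← inner_neg_left, neg_sub]
    rw [h6]
    refine le_of_mul_le_mul_left ?_ ht.1
    nlinarith)
  exact ⟨v, hv, hv2⟩

theorem aux_clm {n m : ℕ} {A : ℕ → EuclideanSpace ℝ (Fin n) →L[ℝ] EuclideanSpace ℝ (Fin m)}
    {A0 : EuclideanSpace ℝ (Fin n) →L[ℝ] EuclideanSpace ℝ (Fin m)}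
    {v : ℕ → EuclideanSpace ℝ (Fin n)} {v0 : EuclideanSpace ℝ (Fin n)}
    (hA : Tendsto A atTop (𝓝 A0)) (hv : Tendsto v atTop (𝓝 v0)) :
    Tendsto (fun k => A k (v k)) atTop (𝓝 (A0 v0)) :=
  ((isBoundedBilinearMap_apply (𝕜 := ℝ) (E := EuclideanSpace ℝ (Fin n))
    (F := EuclideanSpace ℝ (Fin m))).continuous.tendsto (A0, v0)).comp (hA.prodMk_nhds hv)

theorem aux_closed {n m : ℕ}
    {c : EuclideanSpace ℝ (Fin n) → EuclideanSpace ℝ (Fin m)}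
    {cp : EuclideanSpace ℝ (Fin n) → (EuclideanSpace ℝ (Fin n) →L[ℝ] EuclideanSpace ℝ (Fin m))}
    (hcp : Continuous cp)
    {h : EuclideanSpace ℝ (Fin m) → ℝ} (hcont : Continuous h)
    {xn : ℕ → EuclideanSpace ℝ (Fin n)} {un yn : ℕ → EuclideanSpace ℝ (Fin m)}
    {x : EuclideanSpace ℝ (Fin n)} {y : EuclideanSpace ℝ (Fin m)}
    (hx : Tendsto xn atTop (𝓝 x)) (hu : Tendsto un atTop (𝓝 (c x)))
    (hy : Tendsto yn atTop (𝓝 y)) (hsub : ∀ k, yn k ∈ convexSubdiff h (un k))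
    (hg : Tendsto (fun k => nablaC cp (xn k) (yn k)) atTop (𝓝 0)) :
    (0 : EuclideanSpace ℝ (Fin n)) ∈ compSubdiff c cp h x := by
  refine ⟨y, ?_, ?_⟩
  · intro z
    have h1 : Tendsto (fun k => h (un k) + ⟪yn k, z - un k⟫) atTop (𝓝 (h (c x) + ⟪y, z - c x⟫)) :=
      ((hcont.tendsto _).comp hu).add (hy.inner (tendsto_const_nhds.sub hu))
    exact le_of_tendsto' h1 fun k => hsub k z
  · have h1 : Tendsto (fun k => nablaC cp (xn k)) atTop (𝓝 (nablaC cp x)) := by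
      have : Continuous (nablaC cp) := ContinuousLinearMap.adjoint.continuous.comp hcp
      exact (this.tendsto x).comp hx
    exact tendsto_nhds_unique (aux_clm h1 hy) hg

theorem aux_isClosed {n m : ℕ}
    {c : EuclideanSpace ℝ (Fin n) → EuclideanSpace ℝ (Fin m)}
    {cp : EuclideanSpace ℝ (Fin n) → (EuclideanSpace ℝ (Fin n) →L[ℝ] EuclideanSpace ℝ (Fin m))}
    {β : ℝ≥0} (hc : ∀ x, HasFDerivAt c (cp x) x) (hβ : LipschitzWith β cp)
    {h : EuclideanSpace ℝ (Fin m) → ℝ} {L : ℝ≥0} (hL : LipschitzWith L h) :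
    IsClosed {p | (0 : EuclideanSpace ℝ (Fin n)) ∈ compSubdiff c cp h p} := by
  have hcc : Continuous c := continuous_iff_continuousAt.2 fun x => (hc x).continuousAt
  apply IsSeqClosed.isClosed
  intro xn x hxn hx
  choose v hv hv2 using hxn
  obtain ⟨y, -, φ, hφ, hy⟩ := (isCompact_closedBall (0 : EuclideanSpace ℝ (Fin m)) (L : ℝ)).tendsto_subseq
    (x := v) (fun k => by simpa using aux_norm_le hL (hv k))
  refine aux_closed hβ.continuous hL.continuous (hx.comp hφ.tendsto_atTop)
    (((hcc.tendsto x).comp hx).comp hφ.tendsto_atTop) hy (fun k => hv (φ k)) ?_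
  have : (fun k => nablaC cp ((xn ∘ φ) k) ((v ∘ φ) k)) = fun _ => 0 := funext fun k => hv2 (φ k)
  rw [this]; exact tendsto_const_nhds

theorem aux_prox_bound {n m : ℕ}
    {c : EuclideanSpace ℝ (Fin n) → EuclideanSpace ℝ (Fin m)}
    {cp : EuclideanSpace ℝ (Fin n) → (EuclideanSpace ℝ (Fin n) →L[ℝ] EuclideanSpace ℝ (Fin m))}
    {β : ℝ≥0} (hc : ∀ x, HasFDerivAt c (cp x) x) (hβ : LipschitzWith β cp)
    {h : EuclideanSpace ℝ (Fin m) → ℝ} {L : ℝ≥0} (hL : LipschitzWith L h)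
    {ε eb : ℝ} (hε : 0 < ε) (heb : ε ≤ eb) {x : EuclideanSpace ℝ (Fin n)}
    {y : EuclideanSpace ℝ (Fin m)}
    (hy : y ∈ convexSubdiff h (c x - ε • cp x (nablaC cp x y)))
    {z : EuclideanSpace ℝ (Fin n)}
    (hz : ∀ w, h (c z) + (L * β + 1) * ‖z - x‖ ^ 2 ≤ h (c w) + (L * β + 1) * ‖w - x‖ ^ 2) :
    ‖z - x‖ ≤ (1 + (2 * (L * β) + 1) * eb ^ 2) * ‖nablaC cp x y‖ := by
  set g := nablaC cp x y with hg
  set ρ : ℝ := L * β with hρ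
  have hρ0 : 0 ≤ ρ := by positivity
  have h1 := hz (x - ε • g)
  have h2 : x - ε • g - x = -(ε • g) := by abel
  rw [h2, norm_neg, norm_smul, mul_pow, Real.norm_eq_abs, sq_abs] at h1
  have h3 := (abs_le.1 (aux_step_model hc hβ hL x g ε)).2
  have h4 := aux_lin hy z
  have h5 := (abs_le.1 (aux_model hc hβ hL x z)).1
  rw [← hg] at h4
  rw [← hρ] at h3 h5
  have h6 := (abs_le.1 (abs_real_inner_le_norm g (z - x))).1
  have h7 : 0 ≤ ε * ‖g‖ ^ 2 := by positivity
  have h8 : ‖z - x‖ ^ 2 ≤ ‖g‖ * ‖z - x‖ + (2 * ρ + 1) * (ε ^ 2 * ‖g‖ ^ 2) := by nlinarith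
  have h9 : (2 * ρ + 1) * (ε ^ 2 * ‖g‖ ^ 2) ≤ (2 * ρ + 1) * (eb ^ 2 * ‖g‖ ^ 2) := by gcongr
  set U := ‖z - x‖
  set G := ‖g‖ with hG
  have hG0 : 0 ≤ G := norm_nonneg _
  by_contra hcon
  push Not at hcon
  have hP : 0 ≤ (2 * ρ + 1) * eb ^ 2 := by positivity
  set P := (2 * ρ + 1) * eb ^ 2 with hPdef
  have hUG : G ≤ U := by nlinarith
  have hU0 : 0 < U := lt_of_le_of_lt (by positivity) hcon
  have e1 : U ^ 2 ≤ G * U + P * G ^ 2 := by rw [hPdef]; linarith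
  have e2 : P * G ^ 2 ≤ P * G * U := by nlinarith [mul_nonneg hP hG0]
  nlinarith

theorem aux_error {n m : ℕ}
    {c : EuclideanSpace ℝ (Fin n) → EuclideanSpace ℝ (Fin m)}
    {cp : EuclideanSpace ℝ (Fin n) → (EuclideanSpace ℝ (Fin n) →L[ℝ] EuclideanSpace ℝ (Fin m))}
    {β : ℝ≥0} (hc : ∀ x, HasFDerivAt c (cp x) x) (hβ : LipschitzWith β cp)
    {h : EuclideanSpace ℝ (Fin m) → ℝ} {L : ℝ≥0}
    (hconv : ConvexOn ℝ Set.univ h) (hL : LipschitzWith L h)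
    (hbddh : BddBelow (Set.range h)) {X : Set (EuclideanSpace ℝ (Fin n))} (hX : IsCompact X)
    (hsubreg : ∀ xbar ∈ {p | (0 : EuclideanSpace ℝ (Fin n)) ∈ compSubdiff c cp h p} ∩ X,
      ∃ κ > (0 : ℝ), ∃ τ₀ > (0 : ℝ), ∀ q : EuclideanSpace ℝ (Fin n), ‖q - xbar‖ < τ₀ →
        Metric.infDist q {p | (0 : EuclideanSpace ℝ (Fin n)) ∈ compSubdiff c cp h p} ≤
          κ * Metric.infDist 0 (compSubdiff c cp h q))
    (eb : ℝ) :
    ∃ κ > (0 : ℝ), ∃ γ > (0 : ℝ), ∀ x ∈ X, ∀ ε, 0 < ε → ε ≤ eb →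
      ∀ y ∈ convexSubdiff h (c x - ε • cp x (nablaC cp x y)), ‖nablaC cp x y‖ ≤ γ →
      ∃ xh, (0 : EuclideanSpace ℝ (Fin n)) ∈ compSubdiff c cp h xh ∧
        ‖x - xh‖ ≤ κ * ‖nablaC cp x y‖ := by
  have hcc : Continuous c := continuous_iff_continuousAt.2 fun x => (hc x).continuousAt
  by_contra hcon
  push Not at hcon
  have hcon' := fun k : ℕ => hcon (k + 1) (by positivity) (1 / ((k : ℝ) + 1)) (by positivity)
  choose xn hxn en hen henb yn hyn hgn hfar using hcon'
  have hyn' : ∀ k, yn k ∈ Metric.closedBall (0 : EuclideanSpace ℝ (Fin m)) (L : ℝ) :=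
    fun k => by simpa using aux_norm_le hL (hyn k)
  obtain ⟨⟨xs, ys⟩, hmem, φ, hφ, hlim⟩ := (hX.prod (isCompact_closedBall
    (0 : EuclideanSpace ℝ (Fin m)) (L : ℝ))).tendsto_subseq (x := fun k => (xn k, yn k))
    (fun k => ⟨hxn k, hyn' k⟩)
  have hxlim : Tendsto (fun k => xn (φ k)) atTop (𝓝 xs) := (continuous_fst.tendsto _).comp hlim
  have hylim : Tendsto (fun k => yn (φ k)) atTop (𝓝 ys) := (continuous_snd.tendsto _).comp hlim
  have hglim0 : Tendsto (fun k => nablaC cp (xn k) (yn k)) atTop (𝓝 0) :=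
    squeeze_zero_norm hgn tendsto_one_div_add_atTop_nhds_zero_nat
  have hglim := hglim0.comp hφ.tendsto_atTop
  have hst : (0 : EuclideanSpace ℝ (Fin n)) ∈ compSubdiff c cp h xs := by
    refine aux_closed hβ.continuous hL.continuous hxlim ?_ hylim (fun k => hyn (φ k)) hglim
    have h1 : Tendsto (fun k => cp (xn (φ k)) (nablaC cp (xn (φ k)) (yn (φ k)))) atTop (𝓝 0) := by
      have := aux_clm ((hβ.continuous.tendsto xs).comp hxlim) hglim
      simpa using this
    have h2 : Tendsto (fun k => en (φ k) • cp (xn (φ k)) (nablaC cp (xn (φ k)) (yn (φ k))))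
        atTop (𝓝 0) := by
      have h3 : Tendsto (fun k => eb * ‖cp (xn (φ k)) (nablaC cp (xn (φ k)) (yn (φ k)))‖)
        atTop (𝓝 0) := by simpa using h1.norm.const_mul eb
      refine squeeze_zero_norm (fun k => ?_) h3
      rw [norm_smul, Real.norm_of_nonneg (hen _).le]
      gcongr
      exact henb _
    simpa using ((hcc.tendsto xs).comp hxlim).sub h2
  obtain ⟨κ, hκ, τ, hτ, hreg⟩ := hsubreg xs ⟨hst, hmem.1⟩
  set K : ℝ := L * β + 1 with hK
  have hK0 : 0 < K := by positivity
  choose z hz1 hz2 using fun k => aux_prox hc hβ hconv hL hbddh hK0 (xn k)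
  set M : ℝ := 1 + (2 * (L * β) + 1) * eb ^ 2 with hM
  have hM0 : 0 < M := by positivity
  have hzb : ∀ k, ‖z k - xn k‖ ≤ M * ‖nablaC cp (xn k) (yn k)‖ := fun k =>
    aux_prox_bound hc hβ hL (hen k) (henb k) (hyn k) (hz1 k)
  have hzlim : Tendsto (fun k => z (φ k)) atTop (𝓝 xs) := by
    have h1 : Tendsto (fun k => z (φ k) - xn (φ k)) atTop (𝓝 0) := by
      refine squeeze_zero_norm (fun k => hzb (φ k)) ?_
      simpa using hglim.norm.const_mul M
    simpa using h1.add hxlim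
  have hev : ∀ᶠ k in atTop, ‖z (φ k) - xs‖ < τ := by
    have := hzlim.eventually (Metric.ball_mem_nhds xs hτ)
    simpa [dist_eq_norm] using this
  have hC : ∃ N : ℕ, M + κ * (2 * K * M) ≤ N := exists_nat_ge _
  obtain ⟨N, hN⟩ := hC
  obtain ⟨k, hk1, hk2⟩ := (hev.and (eventually_ge_atTop N)).exists
  have hr := hreg _ hk1
  have hd : Metric.infDist 0 (compSubdiff c cp h (z (φ k))) ≤
      2 * K * (M * ‖nablaC cp (xn (φ k)) (yn (φ k))‖) := by
    refine (Metric.infDist_le_dist_of_mem (hz2 (φ k))).trans ?_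
    rw [dist_zero_left, norm_smul, Real.norm_of_nonneg (by positivity), norm_sub_rev]
    have := hzb (φ k)
    gcongr
  obtain ⟨xh, hxh, hxhd⟩ := (aux_isClosed hc hβ hL).exists_infDist_eq_dist ⟨xs, hst⟩ (z (φ k))
  rw [hxhd, dist_eq_norm] at hr
  have hf := hfar (φ k) xh hxh
  have hb := hzb (φ k)
  have htri : ‖xn (φ k) - xh‖ ≤ ‖z (φ k) - xn (φ k)‖ + ‖z (φ k) - xh‖ := by
    rw [norm_sub_rev (z (φ k)) (xn (φ k))]
    exact norm_sub_le_norm_sub_add_norm_sub _ _ _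
  have hNk : (N : ℝ) ≤ (φ k : ℝ) := by exact_mod_cast hk2.trans (hφ.id_le k)
  set G := ‖nablaC cp (xn (φ k)) (yn (φ k))‖
  have hG0 : 0 ≤ G := norm_nonneg _
  have h5 : ‖xn (φ k) - xh‖ ≤ (M + κ * (2 * K * M)) * G := by
    have := mul_le_mul_of_nonneg_left hd hκ.le
    nlinarith
  nlinarith [mul_le_mul_of_nonneg_right (hN.trans hNk) hG0]

theorem aux_lip {n m : ℕ}
    {c : EuclideanSpace ℝ (Fin n) → EuclideanSpace ℝ (Fin m)}
    {cp : EuclideanSpace ℝ (Fin n) → (EuclideanSpace ℝ (Fin n) →L[ℝ] EuclideanSpace ℝ (Fin m))}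
    {β : ℝ≥0} (hc : ∀ x, HasFDerivAt c (cp x) x) (hβ : LipschitzWith β cp)
    {h : EuclideanSpace ℝ (Fin m) → ℝ} {L : ℝ≥0} (hL : LipschitzWith L h)
    {x xh : EuclideanSpace ℝ (Fin n)} {B : ℝ} (hB : ‖cp x‖ ≤ B) :
    |h (c x) - h (c xh)| ≤ L * (B * ‖x - xh‖) + L * β * ‖x - xh‖ ^ 2 := by
  have h1 := aux_model hc hβ hL x xh
  have h2 := hL.norm_sub_le (c x) (c x + cp x (xh - x))
  have h3 : ‖c x - (c x + cp x (xh - x))‖ ≤ B * ‖x - xh‖ := by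
    rw [sub_add_cancel_left, norm_neg, norm_sub_rev x xh]
    exact ((cp x).le_opNorm _).trans (by gcongr)
  have h4 : (L : ℝ) * ‖c x - (c x + cp x (xh - x))‖ ≤ L * (B * ‖x - xh‖) := by gcongr
  rw [Real.norm_eq_abs] at h2
  rw [norm_sub_rev] at h1
  rw [abs_le] at *
  constructor <;> linarith

theorem aux_ratio {n m : ℕ}
    {c : EuclideanSpace ℝ (Fin n) → EuclideanSpace ℝ (Fin m)}
    {cp : EuclideanSpace ℝ (Fin n) → (EuclideanSpace ℝ (Fin n) →L[ℝ] EuclideanSpace ℝ (Fin m))}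
    {β : ℝ≥0} (hc : ∀ x, HasFDerivAt c (cp x) x) (hβ : LipschitzWith β cp)
    {h : EuclideanSpace ℝ (Fin m) → ℝ} {L : ℝ≥0} (hL : LipschitzWith L h)
    {x xh : EuclideanSpace ℝ (Fin n)} {B : ℝ} (hB : ‖cp x‖ ≤ B)
    (hxh : (0 : EuclideanSpace ℝ (Fin n)) ∈ compSubdiff c cp h xh) (hd : ‖x - xh‖ ≤ 1)
    {ε : ℝ} (hε : 0 < ε) (hε1 : 6 * (L * β) * ε ≤ 1) {y : EuclideanSpace ℝ (Fin m)}
    (hy : y ∈ convexSubdiff h (c x - ε • cp x (nablaC cp x y))) :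
    ε * ‖nablaC cp x y‖ ^ 2 ≤ 2 * (L * B + 3 * (L * β)) * ‖x - xh‖ := by
  have hstat : ∀ w, h (c xh) - L * β * ‖w - xh‖ ^ 2 ≤ h (c w) := by
    intro w
    obtain ⟨v, hv, hv0⟩ := hxh
    have h1 := hv (c xh + cp xh (w - xh))
    rw [add_sub_cancel_left, ← ContinuousLinearMap.adjoint_inner_left] at h1
    change nablaC cp xh v = 0 at hv0
    change _ + ⟪nablaC cp xh v, _⟫ ≤ _ at h1
    rw [hv0, inner_zero_left] at h1
    have h2 := (abs_le.1 (aux_model hc hβ hL xh w)).1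
    linarith
  set g := nablaC cp x y with hg
  set ρ : ℝ := L * β with hρ
  have hρ0 : 0 ≤ ρ := by positivity
  have h1 := aux_lin hy x
  rw [← hg] at h1
  simp only [sub_self, inner_zero_right, map_zero, add_zero, zero_add] at h1
  have h2 := (abs_le.1 (aux_step_model hc hβ hL x g ε)).2
  have h3 := hstat (x - ε • g)
  have h4 := (abs_le.1 (aux_lip hc hβ hL (xh := xh) hB)).2
  rw [← hρ] at h2 h4
  have h5 : ‖x - ε • g - xh‖ ≤ ‖x - xh‖ + ε * ‖g‖ := by
    have : x - ε • g - xh = (x - xh) - ε • g := by abel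
    rw [this]
    refine (norm_sub_le _ _).trans ?_
    rw [norm_smul, Real.norm_of_nonneg hε.le]
  have h6 : ‖x - ε • g - xh‖ ^ 2 ≤ 2 * ‖x - xh‖ ^ 2 + 2 * (ε ^ 2 * ‖g‖ ^ 2) := by
    have : ‖x - ε • g - xh‖ ^ 2 ≤ (‖x - xh‖ + ε * ‖g‖) ^ 2 := by gcongr
    nlinarith [sq_nonneg (‖x - xh‖ - ε * ‖g‖)]
  have h7 := mul_le_mul_of_nonneg_left h6 hρ0
  have h8 : ‖x - xh‖ ^ 2 ≤ ‖x - xh‖ := by nlinarith [norm_nonneg (x - xh)]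
  have h9 := mul_le_mul_of_nonneg_left h8 hρ0
  have h10 : 6 * ρ * ε * (ε * ‖g‖ ^ 2) ≤ 1 * (ε * ‖g‖ ^ 2) := by gcongr
  nlinarith

theorem aux_quad {n m : ℕ}
    {c : EuclideanSpace ℝ (Fin n) → EuclideanSpace ℝ (Fin m)}
    {cp : EuclideanSpace ℝ (Fin n) → (EuclideanSpace ℝ (Fin n) →L[ℝ] EuclideanSpace ℝ (Fin m))}
    {β : ℝ≥0} (hc : ∀ x, HasFDerivAt c (cp x) x) (hβ : LipschitzWith β cp)
    {h : EuclideanSpace ℝ (Fin m) → ℝ} {L : ℝ≥0} (hL : LipschitzWith L h)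
    {ε eb κ : ℝ} (hε : 0 < ε) (heb : ε ≤ eb) {x xh : EuclideanSpace ℝ (Fin n)}
    {y : EuclideanSpace ℝ (Fin m)}
    (hy : y ∈ convexSubdiff h (c x - ε • cp x (nablaC cp x y)))
    (hd : ‖x - xh‖ ≤ κ * ‖nablaC cp x y‖) :
    h (c (x - ε • nablaC cp x y)) - h (c xh) ≤
      (L * β * eb ^ 2 + L * β * κ ^ 2 + κ) * ‖nablaC cp x y‖ ^ 2 := by
  set g := nablaC cp x y with hg
  set ρ : ℝ := L * β with hρ
  have hρ0 : 0 ≤ ρ := by positivity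
  have h1 := aux_lin hy xh
  have h2 := (abs_le.1 (aux_step_model hc hβ hL x g ε)).2
  have h3 := (abs_le.1 (aux_model hc hβ hL x xh)).1
  rw [← hg] at h1
  rw [← hρ] at h2 h3
  have h6 := (abs_le.1 (abs_real_inner_le_norm g (xh - x))).1
  rw [norm_sub_rev xh x] at h6 h3
  have h7 : 0 ≤ ε * ‖g‖ ^ 2 := by positivity
  have h8 : ρ * (ε ^ 2 * ‖g‖ ^ 2) ≤ ρ * (eb ^ 2 * ‖g‖ ^ 2) := by gcongr
  have h9 : ρ * ‖x - xh‖ ^ 2 ≤ ρ * (κ * ‖g‖) ^ 2 := by gcongr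
  have h10 : ‖g‖ * ‖x - xh‖ ≤ ‖g‖ * (κ * ‖g‖) := by gcongr
  nlinarith

theorem aux_rate {E : Type*} [NormedAddCommGroup E] [CompleteSpace E] {xs : ℕ → E} {D : ℕ → ℝ}
    {q A : ℝ} (hq : q ∈ Set.Ioo (0 : ℝ) 1) (hA : 0 ≤ A) {N : ℕ}
    (h1 : ∀ k ≥ N, D (k + 1) ≤ q * D k)
    (h2 : ∀ k ≥ N, ‖xs (k + 1) - xs k‖ ^ 2 ≤ A * D k) :
    ∃ xbar, Tendsto xs atTop (𝓝 xbar) ∧ ∃ C > (0 : ℝ), ∀ k ≥ N,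
      ‖xs k - xbar‖ ≤ C * q ^ ((k : ℝ) / 2) := by
  set s := Real.sqrt q with hs
  have hs0 : 0 < s := Real.sqrt_pos.2 hq.1
  have hs1 : s < 1 := by rw [hs, Real.sqrt_lt' one_pos]; simpa using hq.2
  have hsq : s ^ 2 = q := Real.sq_sqrt hq.1.le
  have hD : ∀ j, D (j + N) ≤ q ^ j * D N := by
    intro j
    induction j with
    | zero => simp
    | succ j ih =>
      have := h1 (j + N) (by omega)
      rw [show j + 1 + N = j + N + 1 by ring, pow_succ]
      have := mul_le_mul_of_nonneg_left ih hq.1.le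
      nlinarith
  set C2 := Real.sqrt (A * D N) with hC2
  have hstep : ∀ j, dist (xs (j + N)) (xs (j + 1 + N)) ≤ C2 * s ^ j := by
    intro j
    rw [dist_comm, dist_eq_norm, show j + 1 + N = j + N + 1 by ring]
    have e1 := h2 (j + N) (by omega)
    have e2 : A * D (j + N) ≤ (A * D N) * (s ^ j) ^ 2 := by
      rw [← pow_mul, mul_comm j 2, pow_mul, hsq]
      have := mul_le_mul_of_nonneg_left (hD j) hA
      nlinarith
    have e3 := Real.le_sqrt_of_sq_le (e1.trans e2)
    rwa [Real.sqrt_mul' _ (by positivity), Real.sqrt_sq (by positivity)] at e3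
  obtain ⟨xbar, hx⟩ := cauchySeq_tendsto_of_complete (cauchySeq_of_le_geometric s C2 hs1 hstep)
  refine ⟨xbar, (tendsto_add_atTop_iff_nat N).1 hx, C2 / (1 - s) / s ^ N + 1, ?_, ?_⟩
  · have : 0 < 1 - s := by linarith
    positivity
  · intro k hk
    have h3 := dist_le_of_le_geometric_of_tendsto s C2 hs1 hstep hx (k - N)
    rw [Nat.sub_add_cancel hk, dist_eq_norm] at h3
    have h4 : q ^ ((k : ℝ) / 2) = s ^ k := by
      rw [hs, Real.sqrt_eq_rpow, ← Real.rpow_natCast, ← Real.rpow_mul hq.1.le]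
      congr 1; ring
    rw [h4]
    have h5 : s ^ (k - N) * s ^ N = s ^ k := by rw [← pow_add, Nat.sub_add_cancel hk]
    have h6 : C2 * s ^ (k - N) / (1 - s) = C2 / (1 - s) / s ^ N * s ^ k := by
      rw [← h5]
      have : 1 - s ≠ 0 := by linarith
      field_simp
    rw [h6] at h3
    have : 0 < s ^ k := by positivity
    linarith

end Helpers

set_option maxHeartbeats 4000000

/-- local linear convergence of Algorithm 2 on composite problems:
under compactness of the level set, metric subregularity at all stationary points
in it, and separation of isocost surfaces on the stationary set, the iterates
converge to a stationary point x̄, and eventually both the function values and the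
iterates converge linearly. -/
theorem alg2_local_linear_convergence {n m : ℕ}
    (c : EuclideanSpace ℝ (Fin n) → EuclideanSpace ℝ (Fin m))
    (cp : EuclideanSpace ℝ (Fin n) → (EuclideanSpace ℝ (Fin n) →L[ℝ] EuclideanSpace ℝ (Fin m)))
    (β : ℝ≥0) (hc : ∀ x, HasFDerivAt c (cp x) x) (hβ : LipschitzWith β cp)
    (h : EuclideanSpace ℝ (Fin m) → ℝ) (L : ℝ≥0)
    (hconv : ConvexOn ℝ Set.univ h) (hL : LipschitzWith L h)
    (hbddh : BddBelow (Set.range h))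
    (eps00 nu0 thEps thNu α : ℝ)
    (heps00 : 0 < eps00) (hnu0 : 0 < nu0)
    (hthEps : thEps ∈ Set.Ioo (0 : ℝ) 1) (hthNu : thNu ∈ Set.Ioo (0 : ℝ) 1)
    (hα : α ∈ Set.Ioo (0 : ℝ) 1)
    (a : ℕ → ℝ) (ha_pos : ∀ t, 0 < a t) (ha_anti : Antitone a)
    (ha_lim : Tendsto a atTop (𝓝 0)) (ha_nonsum : ¬ Summable a)
    (xs : ℕ → EuclideanSpace ℝ (Fin n)) (eps0 nu eta teps : ℕ → ℝ)
    (gsel : ℕ → ℕ → EuclideanSpace ℝ (Fin n)) (ik jk : ℕ → ℕ)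
    (tcnt : ℕ → ℕ) (tg : ℕ → EuclideanSpace ℝ (Fin n))
    (hinit_eps : eps0 0 = eps00) (hinit_nu : nu 0 = nu0) (hinit_t : tcnt 0 = 0)
    (hgsel : ∀ k i, gsel k i ∈ Gcomp c cp h (xs k) (eps0 k / 2 ^ i))
    (hterm : ∀ k, InnerTerminates (fun p => h (c p)) α xs eps0 gsel k)
    (hik : ∀ k, (∃ j ≤ ik k, DescStep (fun p => h (c p)) α xs eps0 gsel k (ik k) j) ∧
      ∀ i < ik k, ∀ j ≤ i, ¬ DescStep (fun p => h (c p)) α xs eps0 gsel k i j)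
    (hjk : ∀ k, jk k ≤ ik k ∧ DescStep (fun p => h (c p)) α xs eps0 gsel k (ik k) (jk k) ∧
      ∀ j < jk k, ¬ DescStep (fun p => h (c p)) α xs eps0 gsel k (ik k) j)
    (heta : ∀ k, ∃ j, jk k ≤ j ∧ j ≤ ik k ∧ eta k = eps0 k / 2 ^ j ∧
      ∀ jp, jk k ≤ jp → jp ≤ ik k →
        h (c (xs k - eta k • gsel k (ik k))) ≤
          h (c (xs k - (eps0 k / 2 ^ jp) • gsel k (ik k))))
    (hupd : ∀ k, xs (k + 1) = xs k - eta k • gsel k (ik k))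
    (hsmall : ∀ k, ‖gsel k (ik k)‖ ≤ nu k →
      tcnt (k + 1) = tcnt k + 1 ∧
      teps k = a (tcnt k + 1) ^ ((1 : ℝ) / 4) ∧
      tg k ∈ Gcomp c cp h (xs k) (teps k) ∧
      nu (k + 1) = thNu * nu k ∧
      (teps k * ‖tg k‖ / Real.sqrt ((eps0 k / 2 ^ ik k) * ‖gsel k (ik k)‖) ≤ 1 / eps0 k →
        eps0 (k + 1) = eps0 k) ∧
      (¬ teps k * ‖tg k‖ / Real.sqrt ((eps0 k / 2 ^ ik k) * ‖gsel k (ik k)‖) ≤ 1 / eps0 k →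
        eps0 (k + 1) = thEps * eps0 k))
    (hbig : ∀ k, ¬ ‖gsel k (ik k)‖ ≤ nu k →
      tcnt (k + 1) = tcnt k ∧ nu (k + 1) = nu k ∧ eps0 (k + 1) = eps0 k)
    (hlev : IsCompact {p : EuclideanSpace ℝ (Fin n) | h (c p) ≤ h (c (xs 0))})
    (hsubreg : ∀ xbar ∈ {p | (0 : EuclideanSpace ℝ (Fin n)) ∈ compSubdiff c cp h p} ∩
        {p : EuclideanSpace ℝ (Fin n) | h (c p) ≤ h (c (xs 0))},
      ∃ κ > (0 : ℝ), ∃ τ₀ > (0 : ℝ), ∀ q : EuclideanSpace ℝ (Fin n), ‖q - xbar‖ < τ₀ →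
        Metric.infDist q {p | (0 : EuclideanSpace ℝ (Fin n)) ∈ compSubdiff c cp h p} ≤
          κ * Metric.infDist 0 (compSubdiff c cp h q))
    (hsep : ∃ δ₀ > (0 : ℝ), ∀ p q : EuclideanSpace ℝ (Fin n),
      (0 : EuclideanSpace ℝ (Fin n)) ∈ compSubdiff c cp h p →
      (0 : EuclideanSpace ℝ (Fin n)) ∈ compSubdiff c cp h q →
      h (c p) ≠ h (c q) → δ₀ ≤ ‖p - q‖) :
    ∃ xbar : EuclideanSpace ℝ (Fin n),
      (0 : EuclideanSpace ℝ (Fin n)) ∈ compSubdiff c cp h xbar ∧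
      Tendsto xs atTop (𝓝 xbar) ∧
      ∃ q ∈ Set.Ioo (0 : ℝ) 1, ∃ C > (0 : ℝ), ∃ r : ℕ,
        (∀ k ≥ r, h (c (xs (k + 1))) - h (c xbar) ≤ q * (h (c (xs k)) - h (c xbar))) ∧
        (∀ k ≥ r, ‖xs k - xbar‖ ≤ C * q ^ ((k : ℝ) / 2)) := by
  have hcc : Continuous c := continuous_iff_continuousAt.2 fun x => (hc x).continuousAt
  have hfc : Continuous fun p => h (c p) := hL.continuous.comp hcc
  set X : Set (EuclideanSpace ℝ (Fin n)) := {p | h (c p) ≤ h (c (xs 0))} with hXdef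
  set ρ : ℝ := L * β with hρ
  have hρ0 : 0 ≤ ρ := by positivity
  obtain ⟨hα0, hα1⟩ := hα
  have hG : ∀ x ε g, g ∈ Gcomp c cp h x ε →
      ∃ y ∈ convexSubdiff h (c x - ε • cp x (nablaC cp x y)), nablaC cp x y = g := by
    rintro x ε g ⟨y, hy, rfl⟩
    exact ⟨y, aux_regDual hconv hL.continuous hy, rfl⟩
  choose Y hY hYg using fun k i => hG _ _ _ (hgsel k i)
  have hstepeps : ∀ k, eps0 (k + 1) = eps0 k ∨ eps0 (k + 1) = thEps * eps0 k := by
    intro k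
    by_cases hs : ‖gsel k (ik k)‖ ≤ nu k
    · obtain ⟨-, -, -, -, h1, h2⟩ := hsmall k hs
      by_cases hr : teps k * ‖tg k‖ / Real.sqrt ((eps0 k / 2 ^ ik k) * ‖gsel k (ik k)‖) ≤ 1 / eps0 k
      · exact Or.inl (h1 hr)
      · exact Or.inr (h2 hr)
    · exact Or.inl (hbig k hs).2.2
  have hepsb : ∀ k, 0 < eps0 k ∧ eps0 k ≤ eps00 := by
    intro k
    induction k with
    | zero => rw [hinit_eps]; exact ⟨heps00, le_rfl⟩
    | succ k ih =>
      rcases hstepeps k with h1 | h1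
      · rw [h1]; exact ih
      · rw [h1]
        exact ⟨mul_pos hthEps.1 ih.1, by nlinarith [hthEps.2, ih.1, ih.2]⟩
  have heps0pos : ∀ k, 0 < eps0 k := fun k => (hepsb k).1
  set e : ℕ → ℝ := fun k => eps0 k / 2 ^ ik k with he
  have hepos : ∀ k, 0 < e k := fun k => by have := heps0pos k; positivity
  have heb : ∀ k, e k ≤ eps00 := fun k =>
    (div_le_self (heps0pos k).le (one_le_pow₀ (by norm_num))).trans (hepsb k).2
  set g : ℕ → EuclideanSpace ℝ (Fin n) := fun k => gsel k (ik k) with hg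
  have hpow : ∀ k i j, i ≤ j → eps0 k / 2 ^ j ≤ eps0 k / 2 ^ i := by
    intro k i j hij
    have := (heps0pos k).le
    gcongr
    norm_num
  have hdesc : ∀ k, h (c (xs (k + 1))) ≤ h (c (xs k)) - α * e k * ‖g k‖ ^ 2 := by
    intro k
    obtain ⟨hj1, hj2, -⟩ := hjk k
    obtain ⟨j, -, -, -, hj⟩ := heta k
    have h1 := hj (jk k) le_rfl hj1
    rw [← hupd] at h1
    have h2 : h (c (xs k - (eps0 k / 2 ^ jk k) • gsel k (ik k))) ≤ h (c (xs k)) -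
      α * (eps0 k / 2 ^ jk k) * ‖gsel k (ik k)‖ ^ 2 := hj2
    have h3 := hpow k _ _ hj1
    have h4 : α * e k * ‖g k‖ ^ 2 ≤ α * (eps0 k / 2 ^ jk k) * ‖gsel k (ik k)‖ ^ 2 := by
      simp only [he, hg]; gcongr
    linarith
  have hP : ∀ k, h (c (xs (k + 1))) ≤ h (c (xs k - e k • g k)) := by
    intro k
    obtain ⟨j, -, -, -, hj⟩ := heta k
    have h1 := hj (ik k) (hjk k).1 le_rfl
    rwa [← hupd] at h1
  have hmove : ∀ k, ‖xs (k + 1) - xs k‖ ≤ eps00 * ‖g k‖ := by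
    intro k
    obtain ⟨j, -, -, hj, -⟩ := heta k
    rw [hupd, sub_sub_cancel_left, norm_neg, norm_smul, hj, Real.norm_of_nonneg
      (by have := heps0pos k; positivity)]
    have : eps0 k / 2 ^ j ≤ eps00 :=
      (div_le_self (heps0pos k).le (one_le_pow₀ (by norm_num))).trans (hepsb k).2
    gcongr
  have hnn : ∀ k, 0 ≤ α * e k * ‖g k‖ ^ 2 := fun k => by have := hepos k; positivity
  have hanti : Antitone fun k => h (c (xs k)) :=
    antitone_nat_of_succ_le fun k => by linarith [hdesc k, hnn k]
  have hxX : ∀ k, xs k ∈ X := fun k => hanti (Nat.zero_le k)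
  obtain ⟨fs, hfs⟩ : ∃ fs, Tendsto (fun k => h (c (xs k))) atTop (𝓝 fs) := by
    refine ⟨_, tendsto_atTop_ciInf hanti ?_⟩
    obtain ⟨b, hb⟩ := hbddh
    exact ⟨b, by rintro _ ⟨k, rfl⟩; exact hb ⟨_, rfl⟩⟩
  have hdiff : Tendsto (fun k => h (c (xs k)) - h (c (xs (k + 1)))) atTop (𝓝 0) := by
    simpa using hfs.sub (hfs.comp (tendsto_add_atTop_nat 1))
  set es : ℝ := (1 - α) / (ρ + 1) with hes
  have hes0 : 0 < es := div_pos (by linarith) (by linarith)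
  have hesρ : ρ * es ≤ 1 - α := by
    rw [hes, ← mul_div_assoc, div_le_iff₀ (by linarith)]
    nlinarith
  have helow : ∀ k, min (eps0 k) (es / 2) ≤ e k := by
    intro k
    rcases Nat.eq_zero_or_pos (ik k) with h0 | h0
    · simp [he, h0]
    · refine (min_le_right _ _).trans ?_
      obtain ⟨i, hi⟩ := Nat.exists_eq_succ_of_ne_zero h0.ne'
      have hno := (hik k).2 i (by omega) i le_rfl
      have hlt : es < eps0 k / 2 ^ i := by
        by_contra hcon
        push Not at hcon
        apply hno
        have h1 := aux_desc hc hβ hL (hY k i)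
        rw [hYg, ← hρ] at h1
        change h (c _) ≤ h (c _) - _
        have hp : 0 < eps0 k / 2 ^ i := by have := heps0pos k; positivity
        set E := eps0 k / 2 ^ i
        have h2 : ρ * E ≤ 1 - α := (mul_le_mul_of_nonneg_left hcon hρ0).trans hesρ
        have h3 : 0 ≤ E * ‖gsel k i‖ ^ 2 := by positivity
        nlinarith [mul_le_mul_of_nonneg_right h2 h3]
      simp only [he, hi, Nat.succ_eq_add_one, pow_succ]
      rw [← div_div]
      linarith
  have hnupos : ∀ k, nu k = nu0 * thNu ^ tcnt k := by
    intro k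
    induction k with
    | zero => simp [hinit_nu, hinit_t]
    | succ k ih =>
      by_cases hs : ‖gsel k (ik k)‖ ≤ nu k
      · obtain ⟨h1, -, -, h2, -⟩ := hsmall k hs
        rw [h1, h2, ih, pow_succ]; ring
      · obtain ⟨h1, h2, -⟩ := hbig k hs
        rw [h1, h2, ih]
  have hnu0' : ∀ k, 0 < nu k := fun k => by
    rw [hnupos]; exact mul_pos hnu0 (pow_pos hthNu.1 _)
  have hinf : ∀ N, ∃ k ≥ N, ‖gsel k (ik k)‖ ≤ nu k := by
    intro N
    by_contra hcon
    push Not at hcon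
    have hconst : ∀ k ≥ N, eps0 k = eps0 N ∧ nu k = nu N := by
      intro k hk
      induction k, hk using Nat.le_induction with
      | base => simp
      | succ k hk ih =>
        obtain ⟨-, h1, h2⟩ := hbig k (not_le.2 (hcon k hk))
        rw [h1, h2]; exact ih
    set δ := α * min (eps0 N) (es / 2) * nu N ^ 2 with hδ
    have hδ0 : 0 < δ := by
      have := heps0pos N; have := hnu0' N; positivity
    have h1 : ∀ᶠ k in atTop, h (c (xs k)) - h (c (xs (k + 1))) < δ :=
      hdiff.eventually (gt_mem_nhds hδ0)
    obtain ⟨k, hk1, hk2⟩ := (h1.and (eventually_ge_atTop N)).exists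
    have h2 := hdesc k
    have h3 := helow k
    rw [(hconst k hk2).1] at h3
    have h4 := hcon k hk2
    rw [(hconst k hk2).2] at h4
    have h5 : δ ≤ α * e k * ‖g k‖ ^ 2 := by
      have := (hnu0' N).le
      have := (hepos k).le
      simp only [hδ, hg]
      gcongr
    linarith
  have htmono : Monotone tcnt := monotone_nat_of_le_succ fun k => by
    by_cases hs : ‖gsel k (ik k)‖ ≤ nu k
    · rw [(hsmall k hs).1]; omega
    · rw [(hbig k hs).1]
  have httop : Tendsto tcnt atTop atTop := by
    refine tendsto_atTop_atTop_of_monotone htmono fun b => ?_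
    induction b with
    | zero => exact ⟨0, Nat.zero_le _⟩
    | succ b ih =>
      obtain ⟨k, hk⟩ := ih
      obtain ⟨k', hk', hs⟩ := hinf k
      refine ⟨k' + 1, ?_⟩
      rw [(hsmall k' hs).1]
      have := htmono hk'
      omega
  have hnulim : Tendsto nu atTop (𝓝 0) := by
    have h1 := ((tendsto_pow_atTop_nhds_zero_of_lt_one hthNu.1.le hthNu.2).comp httop).const_mul nu0
    rw [mul_zero] at h1
    exact h1.congr fun k => (hnupos k).symm
  have htelim : Tendsto (fun k => a (tcnt k + 1) ^ ((1 : ℝ) / 4)) atTop (𝓝 0) := by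
    have h1 : Tendsto (fun k => a (tcnt k + 1)) atTop (𝓝 0) :=
      ha_lim.comp ((tendsto_add_atTop_nat 1).comp httop)
    have h2 := h1.rpow_const (p := (1 : ℝ) / 4) (Or.inr (by norm_num))
    rwa [Real.zero_rpow (by norm_num)] at h2
  obtain ⟨κ, hκ, γ, hγ, herr⟩ := aux_error hc hβ hconv hL hbddh hlev hsubreg eps00
  obtain ⟨B, hB⟩ := hlev.exists_bound_of_continuousOn (f := cp) hβ.continuous.continuousOn
  have hB0 : 0 ≤ B := (norm_nonneg _).trans (hB _ (hxX 0))
  set D : ℝ := 2 * (L * B + 3 * ρ) * κ with hD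
  have hD0 : 0 ≤ D := by positivity
  have herrk : ∀ k, ‖g k‖ ≤ γ → ∃ xh, (0 : EuclideanSpace ℝ (Fin n)) ∈ compSubdiff c cp h xh ∧
      ‖xs k - xh‖ ≤ κ * ‖g k‖ := by
    intro k hk
    have := herr (xs k) (hxX k) (e k) (hepos k) (heb k) (Y k (ik k)) (hY k (ik k))
    rw [hYg] at this
    exact this hk
  set es2 : ℝ := min (es / 2) (1 / (D + 1)) with hes2
  have hes20 : 0 < es2 := by positivity
  have hev : ∀ᶠ k in atTop, nu k ≤ γ ∧ κ * nu k ≤ 1 ∧ a (tcnt k + 1) ^ ((1 : ℝ) / 4) ≤ 1 ∧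
      6 * ρ * a (tcnt k + 1) ^ ((1 : ℝ) / 4) ≤ 1 := by
    have h1 := hnulim.eventually (gt_mem_nhds hγ)
    have h2 := (by simpa using hnulim.const_mul κ : Tendsto (fun k => κ * nu k) atTop (𝓝 0)).eventually
      (gt_mem_nhds one_pos)
    have h3 := htelim.eventually (gt_mem_nhds one_pos)
    have h4 := (by simpa using htelim.const_mul (6 * ρ) : Tendsto
      (fun k => 6 * ρ * a (tcnt k + 1) ^ ((1 : ℝ) / 4)) atTop (𝓝 0)).eventually
      (gt_mem_nhds one_pos)
    filter_upwards [h1, h2, h3, h4] with k e1 e2 e3 e4 using ⟨e1.le, e2.le, e3.le, e4.le⟩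
  obtain ⟨K0, hK0⟩ := eventually_atTop.1 hev
  have hkeep : ∀ k ≥ K0, eps0 k ≤ es2 → eps0 (k + 1) = eps0 k := by
    intro k hk hle
    by_cases hs : ‖gsel k (ik k)‖ ≤ nu k
    swap
    · exact (hbig k hs).2.2
    obtain ⟨-, hte, htg, -, hr, -⟩ := hsmall k hs
    apply hr
    obtain ⟨c1, c2, c3, c4⟩ := hK0 k hk
    rw [← hte] at c3 c4
    have hte0 : 0 < teps k := by rw [hte]; exact Real.rpow_pos_of_pos (ha_pos _) _
    have hep := heps0pos k
    rcases (norm_nonneg (gsel k (ik k))).eq_or_lt with h0 | h0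
    · rw [← h0, mul_zero, Real.sqrt_zero, div_zero]; positivity
    obtain ⟨xh, hxh, hxhd⟩ := herrk k (hs.trans c1)
    have hxhd' : ‖xs k - xh‖ ≤ 1 :=
      hxhd.trans ((mul_le_mul_of_nonneg_left hs hκ.le).trans c2)
    obtain ⟨y, hy, hyg⟩ := hG _ _ _ htg
    have h1 := aux_ratio hc hβ hL (hB _ (hxX k)) hxh hxhd' hte0 c4 hy
    rw [hyg, ← hρ] at h1
    have h2 : teps k * ‖tg k‖ ^ 2 ≤ D * ‖g k‖ := by
      refine h1.trans ?_
      calc _ ≤ 2 * (L * B + 3 * ρ) * (κ * ‖g k‖) := by gcongr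
        _ = _ := by rw [hD]; ring
    have h3 : (teps k * ‖tg k‖) ^ 2 ≤ D * ‖g k‖ := by
      calc (teps k * ‖tg k‖) ^ 2 = teps k * (teps k * ‖tg k‖ ^ 2) := by ring
        _ ≤ 1 * (teps k * ‖tg k‖ ^ 2) := by gcongr
        _ ≤ _ := by rw [one_mul]; exact h2
    have h4 : eps0 k ≤ e k := by
      have := helow k
      rwa [min_eq_left (hle.trans (min_le_left _ _))] at this
    have h5 : D * eps0 k ≤ 1 := by
      have := hle.trans (min_le_right _ _)
      rw [le_div_iff₀ (by linarith)] at this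
      nlinarith
    have hpos : 0 < e k * ‖g k‖ := mul_pos (hepos k) h0
    change teps k * ‖tg k‖ / Real.sqrt (e k * ‖g k‖) ≤ 1 / eps0 k
    rw [div_le_div_iff₀ (Real.sqrt_pos.2 hpos) hep, one_mul]
    apply Real.le_sqrt_of_sq_le
    calc (teps k * ‖tg k‖ * eps0 k) ^ 2 = (teps k * ‖tg k‖) ^ 2 * eps0 k ^ 2 := by ring
      _ ≤ D * ‖g k‖ * eps0 k ^ 2 := by gcongr
      _ = (D * eps0 k) * (eps0 k * ‖g k‖) := by ring
      _ ≤ 1 * (e k * ‖g k‖) := by gcongr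
      _ = _ := one_mul _
  set em : ℝ := min (eps0 K0) (thEps * es2) with hem
  have hem0 : 0 < em := lt_min (heps0pos _) (mul_pos hthEps.1 hes20)
  have hemin : ∀ k ≥ K0, em ≤ eps0 k := by
    intro k hk
    induction k, hk using Nat.le_induction with
    | base => exact min_le_left _ _
    | succ k hk ih =>
      rcases le_or_gt (eps0 k) es2 with h1 | h1
      · rw [hkeep k hk h1]; exact ih
      · rcases hstepeps k with h2 | h2
        · rw [h2]; exact ih
        · rw [h2]
          exact (min_le_right _ _).trans (mul_le_mul_of_nonneg_left h1.le hthEps.1.le)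
  set E : ℝ := α * min em (es / 2) with hE
  have hE0 : 0 < E := by positivity
  have hdesc2 : ∀ k ≥ K0, E * ‖g k‖ ^ 2 ≤ h (c (xs k)) - h (c (xs (k + 1))) := by
    intro k hk
    have h1 : min em (es / 2) ≤ e k := (min_le_min_right _ (hemin k hk)).trans (helow k)
    have h2 : E * ‖g k‖ ^ 2 ≤ α * e k * ‖g k‖ ^ 2 := by rw [hE]; gcongr
    linarith [hdesc k]
  have hglim : Tendsto (fun k => ‖g k‖) atTop (𝓝 0) := by
    have h1 : Tendsto (fun k => ‖g k‖ ^ 2) atTop (𝓝 0) := by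
      have h2 : Tendsto (fun k => (h (c (xs k)) - h (c (xs (k + 1)))) / E) atTop (𝓝 0) := by
        simpa using hdiff.div_const E
      refine squeeze_zero' (Eventually.of_forall fun k => by positivity) ?_ h2
      filter_upwards [eventually_ge_atTop K0] with k hk
      rw [le_div_iff₀ hE0, mul_comm]
      exact hdesc2 k hk
    have h2 := h1.sqrt
    simpa [Real.sqrt_sq] using h2
  obtain ⟨K1, hK1⟩ := eventually_atTop.1 (hglim.eventually (gt_mem_nhds hγ))
  choose! xh hxh hxhd using fun k (hk : k ≥ K1) => herrk k (hK1 k hk).le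
  obtain ⟨δ₀, hδ₀, hsep'⟩ := hsep
  have hclose : ∀ᶠ k in atTop, κ * ‖g (k + 1)‖ + eps00 * ‖g k‖ + κ * ‖g k‖ < δ₀ := by
    have h1 : Tendsto (fun k => κ * ‖g (k + 1)‖ + eps00 * ‖g k‖ + κ * ‖g k‖) atTop (𝓝 0) := by
      simpa using (((hglim.comp (tendsto_add_atTop_nat 1)).const_mul κ).add
        (hglim.const_mul eps00)).add (hglim.const_mul κ)
    exact h1.eventually (gt_mem_nhds hδ₀)
  obtain ⟨K2', hK2'⟩ := eventually_atTop.1 hclose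
  set K2 := max K0 (max K1 K2') with hK2
  have hK2a : K0 ≤ K2 := le_max_left _ _
  have hK2b : K1 ≤ K2 := (le_max_left _ _).trans (le_max_right _ _)
  have hK2c : K2' ≤ K2 := (le_max_right _ _).trans (le_max_right _ _)
  have hval : ∀ k ≥ K2, h (c (xh k)) = h (c (xh K2)) := by
    intro k hk
    induction k, hk using Nat.le_induction with
    | base => rfl
    | succ k hk ih =>
      rw [← ih]
      by_contra hne
      have h1 := hsep' _ _ (hxh (k + 1) (by omega)) (hxh k (by omega)) hne
      have h2 := hK2' k (by omega)
      have h3 := hxhd (k + 1) (by omega)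
      have h4 := hxhd k (by omega)
      have h5 := hmove k
      have h6 : ‖xh (k + 1) - xh k‖ ≤ ‖xs (k + 1) - xh (k + 1)‖ + ‖xs (k + 1) - xs k‖
          + ‖xs k - xh k‖ := by
        have e1 := norm_sub_le_norm_sub_add_norm_sub (xh (k + 1)) (xs (k + 1)) (xh k)
        have e2 := norm_sub_le_norm_sub_add_norm_sub (xs (k + 1)) (xs k) (xh k)
        rw [norm_sub_rev (xh (k + 1)) (xs (k + 1))] at e1
        linarith
      linarith
  have hxhlim : Tendsto (fun k => ‖xs k - xh k‖) atTop (𝓝 0) := by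
    refine squeeze_zero' (Eventually.of_forall fun k => norm_nonneg _) ?_
      (by simpa using hglim.const_mul κ : Tendsto (fun k => κ * ‖g k‖) atTop (𝓝 0))
    filter_upwards [eventually_ge_atTop K1] with k hk using hxhd k hk
  have hfsval : fs = h (c (xh K2)) := by
    have h1 : Tendsto (fun k => h (c (xs k)) - h (c (xh k))) atTop (𝓝 0) := by
      refine squeeze_zero_norm (a := fun k => L * (B * ‖xs k - xh k‖) + L * β * ‖xs k - xh k‖ ^ 2)
        (fun k => ?_) ?_
      · rw [Real.norm_eq_abs]
        exact aux_lip hc hβ hL (hB _ (hxX k))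
      · simpa using ((hxhlim.const_mul B).const_mul (L : ℝ)).add
          ((hxhlim.pow 2).const_mul ((L : ℝ) * β))
    have h2 : Tendsto (fun k => h (c (xh k))) atTop (𝓝 fs) := by
      simpa using hfs.sub h1
    refine tendsto_nhds_unique h2 (tendsto_const_nhds.congr' ?_)
    filter_upwards [eventually_ge_atTop K2] with k hk using (hval k hk).symm
  have hfsle : ∀ k, fs ≤ h (c (xs k)) := fun k => hanti.le_of_tendsto hfs k
  set C1 : ℝ := ρ * eps00 ^ 2 + ρ * κ ^ 2 + κ with hC1
  have hC10 : 0 < C1 := by positivity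
  have hquad : ∀ k ≥ K2, h (c (xs (k + 1))) - fs ≤ C1 * ‖g k‖ ^ 2 := by
    intro k hk
    have h1 := hxhd k (by omega)
    have h2 := hY k (ik k)
    have h3 := aux_quad (κ := κ) (xh := xh k) hc hβ hL (hepos k) (heb k) h2 (by rw [hYg]; exact h1)
    rw [hYg, hval k hk, ← hfsval] at h3
    linarith [hP k]
  set q : ℝ := C1 / (C1 + E) with hq
  have hq01 : q ∈ Set.Ioo (0 : ℝ) 1 :=
    ⟨by positivity, by rw [hq, div_lt_one (by positivity)]; linarith⟩
  have hlin : ∀ k ≥ K2, h (c (xs (k + 1))) - fs ≤ q * (h (c (xs k)) - fs) := by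
    intro k hk
    have h1 := hquad k hk
    have h2 := hdesc2 k (by omega)
    rw [hq, div_mul_eq_mul_div, le_div_iff₀ (by positivity)]
    nlinarith
  obtain ⟨xbar, hxbar, C, hC, hrate⟩ := aux_rate (xs := xs) (D := fun k => h (c (xs k)) - fs)
    (A := eps00 ^ 2 / E) hq01 (by positivity) hlin (by
      intro k hk
      have h1 := hdesc2 k (by omega)
      have h2 := hfsle (k + 1)
      have h3 : ‖xs (k + 1) - xs k‖ ^ 2 ≤ (eps00 * ‖g k‖) ^ 2 := by
        have := hmove k
        gcongr
      refine h3.trans ?_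
      rw [div_mul_eq_mul_div, le_div_iff₀ hE0]
      have h4 : eps00 ^ 2 * (E * ‖g k‖ ^ 2) ≤ eps00 ^ 2 * (h (c (xs k)) - fs) := by
        gcongr
        linarith
      linarith)
  have hfx : fs = h (c xbar) :=
    tendsto_nhds_unique hfs ((hfc.tendsto xbar).comp hxbar)
  refine ⟨xbar, ?_, hxbar, q, hq01, C, hC, K2, ?_, hrate⟩
  · have h1 : Tendsto xh atTop (𝓝 xbar) := by
      have h2 : Tendsto (fun k => xs k - xh k) atTop (𝓝 0) :=
        tendsto_zero_iff_norm_tendsto_zero.2 hxhlim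
      simpa using hxbar.sub h2
    refine (aux_isClosed hc hβ hL).mem_of_tendsto h1 ?_
    filter_upwards [eventually_ge_atTop K1] with k hk using hxh k hk
  · rw [← hfx]; exact hlin
end
end
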